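/- arXiv:1210.4346 — 3 statements merged into one kernel-verified Lean document; each statement's English description precedes it below -/
import Mathlib

section
/- Let n ≥ 1 and f₁, …, f_m ∈ QC(ℝⁿ). Then there exists a function c : {1,…,m}ⁿ → [0,∞], invariant under permutations of its n arguments, such that for all ε₁, …, ε_m > 0: ∫_{ℝⁿ} ((ε₁ ⊙ f₁) ⊕ (ε₂ ⊙ f₂) ⊕ ⋯ ⊕ (ε_m ⊙ f_m))(x) dx = ∑_{i₁,…,iₙ=1}^{m} ε_{i₁} ε_{i₂} ⋯ ε_{iₙ} · c(i₁,…,iₙ), the integral being the Lebesgue integral with values in [0,∞]. In particular, this integral is a homogeneous polynomial of degree n in (ε₁,…,ε_m) with non-negative (possibly infinite) coefficients. -/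
open MeasureTheory ENNReal Filter Topology

noncomputable section

abbrev En (n : ℕ) := EuclideanSpace ℝ (Fin n)

def QuasiConcave {n : ℕ} (f : En n → ℝ≥0∞) : Prop :=
  ∀ x y : En n, ∀ l : ℝ, 0 < l → l < 1 →
    min (f x) (f y) ≤ f (l • x + (1 - l) • y)

def QC {n : ℕ} (f : En n → ℝ≥0∞) : Prop :=
  UpperSemicontinuous f ∧ QuasiConcave f ∧ ∀ x, f x ≠ ∞

/-- `(λ ⊙ f)(x) = f (x / λ)`. -/
def odot {n : ℕ} (l : ℝ) (f : En n → ℝ≥0∞) : En n → ℝ≥0∞ :=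
  fun x => f (l⁻¹ • x)

/-- The `m`-fold sum `(g₁ ⊕ ⋯ ⊕ g_m)(x) = sup { min_i gᵢ(yᵢ) : y₁ + ⋯ + y_m = x }`. -/
def oplusMany {n m : ℕ} (g : Fin m → En n → ℝ≥0∞) : En n → ℝ≥0∞ :=
  fun x => ⨆ (y : Fin m → En n) (_ : ∑ i, y i = x), ⨅ i, g i (y i)

/-- `V` agrees on the positive orthant with a form of degree `n` in `m` variables having
coefficients in `[0, ∞]`. -/
def IsNonnegForm (n : ℕ) {m : ℕ} (V : (Fin m → ℝ) → ℝ≥0∞) : Prop :=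
  ∃ c : (Fin n → Fin m) → ℝ≥0∞, ∀ ε : Fin m → ℝ, (∀ i, 0 < ε i) →
    V ε = ∑ i : Fin n → Fin m, (∏ j, ENNReal.ofReal (ε (i j))) * c i

namespace IsNonnegForm

variable {n m : ℕ}

theorem congr {V W : (Fin m → ℝ) → ℝ≥0∞} (hV : IsNonnegForm n V)
    (h : ∀ ε : Fin m → ℝ, (∀ i, 0 < ε i) → W ε = V ε) : IsNonnegForm n W := by
  obtain ⟨c, hc⟩ := hV
  exact ⟨c, fun ε hε => (h ε hε).trans (hc ε hε)⟩

theorem zero : IsNonnegForm n (fun _ : Fin m → ℝ => 0) :=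
  ⟨0, fun ε _ => by simp⟩

theorem const_mul {V : (Fin m → ℝ) → ℝ≥0∞} (hV : IsNonnegForm n V) (a : ℝ≥0∞) :
    IsNonnegForm n (fun ε => a * V ε) := by
  obtain ⟨c, hc⟩ := hV
  refine ⟨fun i => a * c i, fun ε hε => ?_⟩
  simp only [hc ε hε, Finset.mul_sum]
  exact Finset.sum_congr rfl fun i _ => mul_left_comm _ _ _

theorem sum {ι : Type*} (s : Finset ι) {V : ι → (Fin m → ℝ) → ℝ≥0∞}
    (hV : ∀ k, IsNonnegForm n (V k)) : IsNonnegForm n (fun ε => ∑ k ∈ s, V k ε) := by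
  choose c hc using hV
  refine ⟨fun i => ∑ k ∈ s, c k i, fun ε hε => ?_⟩
  simp only [hc _ ε hε, Finset.mul_sum]
  exact Finset.sum_comm

/-- Forms with coefficients in `[0, ∞]` are closed under pointwise limits, because `[0, ∞]` is
compact. -/
theorem of_tendsto {V : ℕ → (Fin m → ℝ) → ℝ≥0∞} {W : (Fin m → ℝ) → ℝ≥0∞}
    (hV : ∀ k, IsNonnegForm n (V k))
    (h : ∀ ε : Fin m → ℝ, (∀ i, 0 < ε i) → Tendsto (fun k => V k ε) atTop (𝓝 (W ε))) :
    IsNonnegForm n W := by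
  choose c hc using hV
  have hlim : Tendsto c (hyperfilter ℕ) (𝓝 ((hyperfilter ℕ).map c).lim) :=
    ((hyperfilter ℕ).map c).le_nhds_lim
  refine ⟨((hyperfilter ℕ).map c).lim, fun ε hε => ?_⟩
  have h1 : Tendsto (fun k => V k ε) (hyperfilter ℕ) (𝓝 (W ε)) :=
    (h ε hε).mono_left (Nat.hyperfilter_le_atTop)
  refine tendsto_nhds_unique h1 ?_
  simp only [hc _ ε hε]
  refine tendsto_finsetSum _ fun i _ => ENNReal.Tendsto.const_mul ?_ (Or.inr ?_)
  · exact (tendsto_pi_nhds.1 hlim) i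
  · exact ENNReal.prod_ne_top fun j _ => ENNReal.ofReal_ne_top

/-- The coefficients of a form can be chosen symmetric. -/
theorem exists_symmetric {V : (Fin m → ℝ) → ℝ≥0∞} (hV : IsNonnegForm n V) :
    ∃ c : (Fin n → Fin m) → ℝ≥0∞,
      (∀ (i : Fin n → Fin m) (σ : Equiv.Perm (Fin n)), c (i ∘ σ) = c i) ∧
      ∀ ε : Fin m → ℝ, (∀ i, 0 < ε i) →
        V ε = ∑ i : Fin n → Fin m, (∏ j, ENNReal.ofReal (ε (i j))) * c i := by
  obtain ⟨c, hc⟩ := hV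
  set N : ℝ≥0∞ := (Fintype.card (Equiv.Perm (Fin n)) : ℝ≥0∞)
  have hN0 : N ≠ 0 := by simp [N]
  have hNt : N ≠ ∞ := ENNReal.natCast_ne_top _
  refine ⟨fun i => N⁻¹ * ∑ σ : Equiv.Perm (Fin n), c (i ∘ σ), fun i σ => ?_, fun ε hε => ?_⟩
  · exact congrArg (N⁻¹ * ·) (Fintype.sum_equiv (Equiv.mulLeft σ)
      (fun τ : Equiv.Perm (Fin n) => c ((i ∘ σ) ∘ τ)) (fun τ => c (i ∘ τ)) fun τ => rfl)
  · have key (σ : Equiv.Perm (Fin n)) :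
        ∑ i : Fin n → Fin m, (∏ j, ENNReal.ofReal (ε (i j))) * c (i ∘ σ) = V ε := by
      rw [hc ε hε]
      refine Fintype.sum_equiv (Equiv.arrowCongr σ.symm (Equiv.refl _)) _ _ fun i => ?_
      congr 1
      exact (Equiv.prod_comp σ fun j => ENNReal.ofReal (ε (i j))).symm
    calc V ε = N⁻¹ * (N * V ε) := by
          rw [← mul_assoc, ENNReal.inv_mul_cancel hN0 hNt, one_mul]
      _ = N⁻¹ * ∑ σ : Equiv.Perm (Fin n),
            ∑ i : Fin n → Fin m, (∏ j, ENNReal.ofReal (ε (i j))) * c (i ∘ σ) := by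
          simp [key, N]
      _ = _ := by
          rw [Finset.sum_comm, Finset.mul_sum]
          refine Finset.sum_congr rfl fun i _ => ?_
          rw [← Finset.mul_sum, mul_left_comm]

end IsNonnegForm

/-- The `N`-step lower approximation of `y` by multiples of `d`. -/
def stepApprox (d : ℝ≥0∞) (N : ℕ) (y : ℝ≥0∞) : ℝ≥0∞ :=
  ∑ j ∈ Finset.range N, d * (Set.Ioi ((j + 1 : ℕ) * d)).indicator 1 y

theorem stepApprox_le_and_le (d : ℝ≥0∞) (y : ℝ≥0∞) (N : ℕ) :
    stepApprox d N y ≤ min y (N * d) ∧ min y ((N + 1 : ℕ) * d) ≤ stepApprox d N y + d := by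
  induction N with
  | zero => simp [stepApprox]
  | succ N ih =>
    obtain ⟨h1, h2⟩ := ih
    have hs : stepApprox d (N + 1) y = stepApprox d N y +
        d * (Set.Ioi ((N + 1 : ℕ) * d)).indicator 1 y := Finset.sum_range_succ _ _
    by_cases hy : ((N + 1 : ℕ) : ℝ≥0∞) * d < y
    · rw [Set.indicator_of_mem (Set.mem_Ioi.2 hy), Pi.one_apply, mul_one] at hs
      rw [min_eq_right hy.le] at h2 ⊢
      refine ⟨?_, ?_⟩
      · rw [hs]
        calc _ ≤ N * d + d := by gcongr; exact h1.trans (min_le_right _ _)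
          _ = _ := by push_cast; ring
      · rw [hs]
        calc _ ≤ ((N + 1 + 1 : ℕ) : ℝ≥0∞) * d := min_le_right _ _
          _ = ((N + 1 : ℕ) : ℝ≥0∞) * d + d := by push_cast; ring
          _ ≤ _ := by gcongr
    · rw [Set.indicator_of_notMem (mt Set.mem_Ioi.1 hy), mul_zero, add_zero] at hs
      rw [hs]
      push Not at hy
      rw [min_eq_left hy] at h2 ⊢
      exact ⟨h1.trans (min_le_left _ _), (min_le_left _ _).trans h2⟩

theorem tendsto_stepApprox (y : ℝ≥0∞) :
    Tendsto (fun k : ℕ => stepApprox ((k + 1 : ℕ) : ℝ≥0∞)⁻¹ ((k + 1) * (k + 1)) y) atTop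
      (𝓝 y) := by
  have hinv : Tendsto (fun k : ℕ => ((k + 1 : ℕ) : ℝ≥0∞)⁻¹) atTop (𝓝 0) :=
    ENNReal.tendsto_inv_nat_nhds_zero.comp (tendsto_add_atTop_nat 1)
  have hmin : Tendsto (fun k : ℕ => min y ((k + 1 : ℕ) : ℝ≥0∞)) atTop (𝓝 y) := by
    have := (tendsto_const_nhds (x := y) (f := (atTop : Filter ℕ))).min
      (ENNReal.tendsto_nat_nhds_top.comp (tendsto_add_atTop_nat 1))
    simpa using this
  have hsub := ENNReal.Tendsto.sub hmin hinv (Or.inr ENNReal.zero_ne_top)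
  rw [tsub_zero] at hsub
  refine tendsto_of_tendsto_of_tendsto_of_le_of_le hsub tendsto_const_nhds (fun k => ?_)
    fun k => (stepApprox_le_and_le _ y _).1.trans (min_le_left _ _)
  refine tsub_le_iff_right.2 (le_trans ?_ (stepApprox_le_and_le _ y _).2)
  refine min_le_min le_rfl ?_
  have h0 : ((k + 1 : ℕ) : ℝ≥0∞) ≠ 0 := by simp
  calc ((k + 1 : ℕ) : ℝ≥0∞) = ((k + 1 : ℕ) : ℝ≥0∞) * ((k + 1 : ℕ) : ℝ≥0∞) *
        ((k + 1 : ℕ) : ℝ≥0∞)⁻¹ := by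
        rw [mul_assoc, ENNReal.mul_inv_cancel h0 (ENNReal.natCast_ne_top _), mul_one]
    _ ≤ _ := by
        gcongr
        push_cast
        exact le_self_add

/-- A layer-cake formula in terms of Riemann sums. -/
theorem tendsto_sum_measure_superlevel {α : Type*} [MeasurableSpace α] (μ : Measure α)
    (g : α → ℝ≥0∞) (hg : ∀ t : ℝ≥0∞, NullMeasurableSet {x | t < g x} μ) :
    Tendsto (fun k : ℕ => ∑ j ∈ Finset.range ((k + 1) * (k + 1)),
        ((k + 1 : ℕ) : ℝ≥0∞)⁻¹ * μ {x | (j + 1 : ℕ) * ((k + 1 : ℕ) : ℝ≥0∞)⁻¹ < g x}) atTop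
      (𝓝 (∫⁻ x, g x ∂μ)) := by
  set s : ℕ → α → ℝ≥0∞ := fun k x =>
    stepApprox ((k + 1 : ℕ) : ℝ≥0∞)⁻¹ ((k + 1) * (k + 1)) (g x) with hs
  have hind (t : ℝ≥0∞) : (fun x => (Set.Ioi t).indicator (1 : ℝ≥0∞ → ℝ≥0∞) (g x)) =
      {x | t < g x}.indicator 1 := rfl
  have hm1 (t : ℝ≥0∞) : AEMeasurable
      (fun x => (Set.Ioi t).indicator (1 : ℝ≥0∞ → ℝ≥0∞) (g x)) μ := by
    rw [hind]
    exact aemeasurable_one.indicator₀ (hg t)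
  have hint (k : ℕ) : ∫⁻ x, s k x ∂μ = ∑ j ∈ Finset.range ((k + 1) * (k + 1)),
      ((k + 1 : ℕ) : ℝ≥0∞)⁻¹ * μ {x | (j + 1 : ℕ) * ((k + 1 : ℕ) : ℝ≥0∞)⁻¹ < g x} := by
    simp only [hs, stepApprox]
    rw [lintegral_finsetSum' _ fun j _ => (hm1 _).const_mul _]
    refine Finset.sum_congr rfl fun j _ => ?_
    rw [lintegral_const_mul'' _ (hm1 _), hind, lintegral_indicator_one₀ (hg _)]
  simp only [← hint]
  refine tendsto_of_le_liminf_of_limsup_le ?_ ?_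
  · have h := lintegral_liminf_le' (μ := μ) (u := atTop) (f := s)
      fun k => Finset.aemeasurable_fun_sum _ fun j _ => (hm1 _).const_mul _
    have hl (x : α) : liminf (fun k => s k x) atTop = g x :=
      (tendsto_stepApprox (g x)).liminf_eq
    simpa only [hl] using h
  · refine limsup_le_of_le (h := Eventually.of_forall fun k => lintegral_mono fun x => ?_)
    exact (stepApprox_le_and_le _ _ _).1.trans (min_le_left _ _)

/-- The set of all `∑ i, ε i • z i` with `z i ∈ C i`. -/
def minkowskiComb {n m : ℕ} (ε : Fin m → ℝ) (C : Fin m → Set (En n)) : Set (En n) :=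
  {x | ∃ z : Fin m → En n, (∀ i, z i ∈ C i) ∧ ∑ i, ε i • z i = x}

section minkowskiComb

variable {n m : ℕ}

theorem minkowskiComb_mono {ε : Fin m → ℝ} {C D : Fin m → Set (En n)} (h : ∀ i, C i ⊆ D i) :
    minkowskiComb ε C ⊆ minkowskiComb ε D :=
  fun _ ⟨z, hz, hx⟩ => ⟨z, fun i => h i (hz i), hx⟩

theorem convex_minkowskiComb {ε : Fin m → ℝ} {C : Fin m → Set (En n)}
    (hC : ∀ i, Convex ℝ (C i)) : Convex ℝ (minkowskiComb ε C) := by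
  rintro _ ⟨z, hz, rfl⟩ _ ⟨w, hw, rfl⟩ a b ha hb hab
  refine ⟨fun i => a • z i + b • w i, fun i => hC i (hz i) (hw i) ha hb hab, ?_⟩
  simp only [smul_add, Finset.sum_add_distrib, Finset.smul_sum, smul_comm (ε _)]

theorem minkowskiComb_closure_subset (ε : Fin m → ℝ) (C : Fin m → Set (En n)) :
    minkowskiComb ε (fun i => closure (C i)) ⊆ closure (minkowskiComb ε C) := by
  rintro _ ⟨z, hz, rfl⟩
  have hz' : z ∈ closure (Set.univ.pi C) := by
    rw [closure_pi_set]
    exact fun i _ => hz i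
  have hc : Continuous fun z : Fin m → En n => ∑ i, ε i • z i := by fun_prop
  exact map_mem_closure (f := fun z : Fin m → En n => ∑ i, ε i • z i) hc hz'
    fun w hw => ⟨w, fun i => hw i trivial, rfl⟩

theorem minkowskiComb_iUnion (ε : Fin m → ℝ) {C : ℕ → Fin m → Set (En n)} (hC : Monotone C) :
    minkowskiComb ε (fun i => ⋃ N, C N i) = ⋃ N, minkowskiComb ε (C N) := by
  refine Set.Subset.antisymm ?_
    (Set.iUnion_subset fun N => minkowskiComb_mono fun i => Set.subset_iUnion (C · i) N)
  rintro _ ⟨z, hz, rfl⟩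
  simp only [Set.mem_iUnion] at hz
  choose N hN using hz
  exact Set.mem_iUnion.2 ⟨Finset.univ.sup N, z, fun i =>
    hC (Finset.le_sup (Finset.mem_univ i)) i (hN i), rfl⟩

theorem volume_eq_of_subset_closure {A B : Set (En n)} (hA : Convex ℝ A) (hAB : A ⊆ B)
    (hB : B ⊆ closure A) : volume A = volume B := by
  refine le_antisymm (measure_mono hAB) ?_
  calc volume B ≤ volume (A ∪ frontier A) :=
        measure_mono (hB.trans (closure_eq_self_union_frontier A).subset)
    _ ≤ volume A + volume (frontier A) := measure_union_le _ _
    _ = volume A := by rw [hA.addHaar_frontier volume, add_zero]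

/-- Reduction of the volume of Minkowski combinations of convex sets to that of polytopes. -/
theorem isNonnegForm_volume_minkowskiComb_of_polytope
    (H : ∀ (N : ℕ) (v : Fin m → Fin (N + 1) → En n), IsNonnegForm n
      fun ε => volume (minkowskiComb ε fun i => convexHull ℝ (Set.range (v i))))
    {C : Fin m → Set (En n)} (hC : ∀ i, Convex ℝ (C i)) :
    IsNonnegForm n fun ε => volume (minkowskiComb ε C) := by
  by_cases hne : ∀ i, (C i).Nonempty
  · have hd (i : Fin m) : ∃ u : ℕ → En n, (∀ k, u k ∈ C i) ∧ C i ⊆ closure (Set.range u) := by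
      have := (hne i).to_subtype
      obtain ⟨u, hu⟩ := TopologicalSpace.exists_dense_seq (C i)
      refine ⟨fun k => u k, fun k => (u k).2, fun x hx => ?_⟩
      have := map_mem_closure continuous_subtype_val (hu ⟨x, hx⟩)
        (t := Set.range fun k => (u k : En n))
      refine this ?_
      rintro _ ⟨k, rfl⟩
      exact ⟨k, rfl⟩
    choose u hu hdense using hd
    set P : ℕ → Fin m → Set (En n) := fun N i =>
      convexHull ℝ (Set.range fun k : Fin (N + 1) => u i k) with hP
    have hPmono : Monotone P := by
      intro N M hNM i
      refine convexHull_mono ?_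
      rintro _ ⟨k, rfl⟩
      exact ⟨⟨k, by omega⟩, rfl⟩
    refine IsNonnegForm.of_tendsto (fun N => H N fun i k => u i k) fun ε _ => ?_
    have hmono : Monotone fun N => minkowskiComb ε (P N) :=
      fun N M h => minkowskiComb_mono (hPmono h)
    have hlim := tendsto_measure_iUnion_atTop (μ := volume) hmono
    rw [← minkowskiComb_iUnion ε hPmono] at hlim
    have hPC (i : Fin m) : ⋃ N, P N i ⊆ C i := Set.iUnion_subset fun N =>
      convexHull_min (by rintro _ ⟨k, rfl⟩; exact hu i k) (hC i)
    have hCP (i : Fin m) : C i ⊆ closure (⋃ N, P N i) := by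
      refine (hdense i).trans (closure_mono ?_)
      rintro _ ⟨k, rfl⟩
      exact Set.mem_iUnion.2 ⟨k, subset_convexHull ℝ _ ⟨Fin.last k, rfl⟩⟩
    have hconv (i : Fin m) : Convex ℝ (⋃ N, P N i) :=
      Directed.convex_iUnion (directed_of_isDirected_le fun N M h => hPmono h i)
        fun N => convex_convexHull ℝ _
    rwa [volume_eq_of_subset_closure (convex_minkowskiComb hconv) (minkowskiComb_mono hPC)
      ((minkowskiComb_mono hCP).trans (minkowskiComb_closure_subset ε _))] at hlim
  · push Not at hne
    obtain ⟨i, hi⟩ := hne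
    refine IsNonnegForm.zero.congr fun ε _ => ?_
    have : minkowskiComb ε C = ∅ := by
      refine Set.eq_empty_of_forall_notMem fun x ⟨z, hz, _⟩ => ?_
      simpa [hi] using hz i
    simp [this]

theorem superlevel_oplusMany_odot (hm : 1 ≤ m) (f : Fin m → En n → ℝ≥0∞) {ε : Fin m → ℝ}
    (hε : ∀ i, 0 < ε i) (t : ℝ≥0∞) :
    {x | t < oplusMany (fun i => odot (ε i) (f i)) x} =
      minkowskiComb ε fun i => {z | t < f i z} := by
  have : Nonempty (Fin m) := ⟨⟨0, hm⟩⟩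
  have hinf (g : Fin m → ℝ≥0∞) : t < ⨅ i, g i ↔ ∀ i, t < g i := by
    refine ⟨fun h i => h.trans_le (iInf_le _ _), fun h => ?_⟩
    obtain ⟨i, hi⟩ := exists_eq_ciInf_of_finite (f := g)
    exact hi ▸ h i
  ext x
  simp only [oplusMany, odot, Set.mem_ofPred_eq, lt_iSup_iff, hinf, minkowskiComb]
  constructor
  · rintro ⟨y, hy, h⟩
    refine ⟨fun i => (ε i)⁻¹ • y i, h, ?_⟩
    simpa [smul_smul, mul_inv_cancel₀ (hε _).ne'] using hy
  · rintro ⟨z, hz, h⟩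
    refine ⟨fun i => ε i • z i, h, fun i => ?_⟩
    simpa [smul_smul, inv_mul_cancel₀ (hε i).ne'] using hz i

theorem QuasiConcave.convex_superlevel {f : En n → ℝ≥0∞} (hf : QuasiConcave f) (t : ℝ≥0∞) :
    Convex ℝ {z | t < f z} := by
  refine convex_iff_forall_pos.2 fun x hx y hy a b ha hb hab => ?_
  obtain rfl : b = 1 - a := by linarith
  exact (lt_min hx hy).trans_le (hf x y a ha (by linarith))

theorem volume_minkowskiComb_eq_zero {κ : Type*} [Nonempty κ] (v : Fin m → κ → En n)
    {h : En n} (h0 : h ≠ 0) (hh : ∀ i k l, inner ℝ (v i k - v i l) h = 0) (ε : Fin m → ℝ) :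
    volume (minkowskiComb ε fun i => convexHull ℝ (Set.range (v i))) = 0 := by
  obtain ⟨k⟩ := ‹Nonempty κ›
  have hsub : minkowskiComb ε (fun i => convexHull ℝ (Set.range (v i))) ⊆
      AffineSubspace.mk' (∑ i, ε i • v i k) (innerSL ℝ h).ker := by
    rintro _ ⟨z, hz, rfl⟩
    have hz' (i : Fin m) : inner ℝ h (z i) = inner ℝ h (v i k) := by
      have hconv : Convex ℝ {z : En n | inner ℝ h z = inner ℝ h (v i k)} :=
        convex_hyperplane (innerSL ℝ h).isLinear _
      refine convexHull_min ?_ hconv (hz i)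
      rintro _ ⟨l, rfl⟩
      have := hh i l k
      rwa [real_inner_comm, inner_sub_right, sub_eq_zero] at this
    simp [AffineSubspace.mem_mk', inner_sub_right, inner_sum, real_inner_smul_right, hz']
  refine measure_mono_null hsub (Measure.addHaar_affineSubspace volume _ fun htop => ?_)
  have : h ∈ (innerSL ℝ h).ker := by
    rw [← AffineSubspace.direction_mk' (∑ i, ε i • v i k) (innerSL ℝ h).ker, htop]
    simp
  exact h0 (inner_self_eq_zero (𝕜 := ℝ).1 (by simpa using this))

end minkowskiComb

section rankOneSum

variable {n : ℕ} {A : Type*} [Fintype A]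

theorem factorial_mul_det_sum_mul_mul (c : A → ℝ) (p : A → Fin n → ℝ) :
    (n.factorial : ℝ) * (Matrix.of fun j k => ∑ a, c a * p a j * p a k).det =
      ∑ s : Fin n → A, (∏ j, c (s j)) * (Matrix.of fun j => p (s j)).det ^ 2 := by
  classical
  have h1 : (Matrix.of fun j k => ∑ a, c a * p a j * p a k).det =
      ∑ s : Fin n → A, (∏ j, c (s j)) * ((∏ j, p (s j) j) * (Matrix.of fun j => p (s j)).det) := by
    have h := (Matrix.detRowAlternating (n := Fin n) (R := ℝ)).toMultilinearMap.map_sum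
      fun (j : Fin n) (a : A) => (c a * p a j) • p a
    have h' : (Matrix.of fun j k => ∑ a, c a * p a j * p a k) =
        fun j => ∑ a, (c a * p a j) • p a := by
      ext j k
      simp [Finset.sum_apply]
    rw [h']
    refine h.trans (Finset.sum_congr rfl fun s _ => ?_)
    rw [MultilinearMap.map_smul_univ, Finset.prod_mul_distrib, smul_eq_mul, mul_assoc]
    rfl
  have h2 (σ : Equiv.Perm (Fin n)) : (Matrix.of fun j k => ∑ a, c a * p a j * p a k).det =
      ∑ s : Fin n → A, (∏ j, c (s j)) * (((Equiv.Perm.sign σ : ℤ) : ℝ) * (∏ j, p (s (σ j)) j) *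
        (Matrix.of fun j => p (s j)).det) := by
    rw [h1]
    refine Fintype.sum_equiv (Equiv.arrowCongr σ (Equiv.refl _)) _ _ fun s => ?_
    have hs (j : Fin n) : (Equiv.arrowCongr σ (Equiv.refl A)) s (σ j) = s j := by
      simp [Equiv.arrowCongr]
    have hdet : (Matrix.of fun j => p (s j)).det = ((Equiv.Perm.sign σ : ℤ) : ℝ) *
        (Matrix.of fun j => p ((Equiv.arrowCongr σ (Equiv.refl A)) s j)).det := by
      rw [← Matrix.det_permute]
      congr 1
      ext j k
      simp
    simp only [hs]
    rw [hdet, ← Equiv.prod_comp σ fun j => c ((Equiv.arrowCongr σ (Equiv.refl A)) s j)]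
    simp only [hs]
    ring
  calc (n.factorial : ℝ) * (Matrix.of fun j k => ∑ a, c a * p a j * p a k).det
      = ∑ _σ : Equiv.Perm (Fin n), (Matrix.of fun j k => ∑ a, c a * p a j * p a k).det := by
        simp [Fintype.card_perm]
    _ = ∑ σ : Equiv.Perm (Fin n), ∑ s : Fin n → A, (∏ j, c (s j)) *
          (((Equiv.Perm.sign σ : ℤ) : ℝ) * (∏ j, p (s (σ j)) j) *
            (Matrix.of fun j => p (s j)).det) := Finset.sum_congr rfl fun σ _ => h2 σ
    _ = _ := by
        rw [Finset.sum_comm]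
        refine Finset.sum_congr rfl fun s _ => ?_
        rw [← Finset.mul_sum, ← Finset.sum_mul, sq]
        congr 2
        rw [Matrix.det_apply']
        simp

/-- The operator `∑ a, c a • (p a ⊗ p a)`. -/
def rankOneSum (c : A → ℝ) (p : A → En n) : En n →L[ℝ] En n :=
  ∑ a, c a • (innerSL ℝ (p a)).smulRight (p a)

theorem rankOneSum_apply (c : A → ℝ) (p : A → En n) (h : En n) :
    rankOneSum c p h = ∑ a, (c a * inner ℝ (p a) h) • p a := by
  simp [rankOneSum, smul_smul]

theorem inner_rankOneSum_self (c : A → ℝ) (p : A → En n) (h : En n) :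
    inner ℝ (rankOneSum c p h) h = ∑ a, c a * inner ℝ (p a) h ^ 2 := by
  simp only [rankOneSum_apply, sum_inner, real_inner_smul_left]
  exact Finset.sum_congr rfl fun a _ => by ring

theorem det_rankOneSum (c : A → ℝ) (p : A → En n) :
    (rankOneSum c p).det = ∑ s : Fin n → A,
      (∏ j, c (s j)) * ((Matrix.of fun j k => p (s j) k).det ^ 2 / n.factorial) := by
  have hM : LinearMap.toMatrix (EuclideanSpace.basisFun (Fin n) ℝ).toBasis
      (EuclideanSpace.basisFun (Fin n) ℝ).toBasis (rankOneSum c p : En n →ₗ[ℝ] En n) =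
      Matrix.of fun j k => ∑ a, c a * p a j * p a k := by
    ext j k
    simp only [LinearMap.toMatrix_apply, OrthonormalBasis.coe_toBasis,
      OrthonormalBasis.coe_toBasis_repr_apply, EuclideanSpace.basisFun_repr,
      EuclideanSpace.basisFun_apply, ContinuousLinearMap.coe_coe, rankOneSum_apply,
      Matrix.of_apply]
    simp only [WithLp.ofLp_sum, WithLp.ofLp_smul, Finset.sum_apply, Pi.smul_apply, smul_eq_mul,
      EuclideanSpace.inner_single_right]
    refine Finset.sum_congr rfl fun a _ => ?_
    simp
    ring
  have hn : (n.factorial : ℝ) ≠ 0 := Nat.cast_ne_zero.2 n.factorial_ne_zero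
  rw [ContinuousLinearMap.det,
    ← LinearMap.det_toMatrix (EuclideanSpace.basisFun (Fin n) ℝ).toBasis, hM]
  simp only [← mul_div_assoc]
  rw [← Finset.sum_div, eq_div_iff hn, mul_comm]
  exact factorial_mul_det_sum_mul_mul c fun a k => p a k

theorem injective_of_hasFDerivAt_rankOneSum {T : En n → En n} {c : En n → A → ℝ} {p : A → En n}
    (hT : ∀ x, HasFDerivAt T (rankOneSum (c x) p) x) (hc : ∀ x a, 0 < c x a)
    (hp : ∀ h, (∀ a, inner ℝ (p a) h = 0) → h = 0) : Function.Injective T := by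
  intro x y hxy
  by_contra hne
  have hh : y - x ≠ 0 := sub_ne_zero.2 (Ne.symm hne)
  set g : ℝ → ℝ := fun s => inner ℝ (T (x + s • (y - x))) (y - x) with hg
  have hder (s : ℝ) : HasDerivAt g
      (∑ a, c (x + s • (y - x)) a * inner ℝ (p a) (y - x) ^ 2) s := by
    have h1 : HasDerivAt (fun s : ℝ => x + s • (y - x)) (y - x) s := by
      simpa using ((hasDerivAt_id s).smul_const (y - x)).const_add x
    have h2 := (hT _).comp_hasDerivAt s h1
    have h3 := h2.inner ℝ (hasDerivAt_const s (y - x))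
    rw [← inner_rankOneSum_self]
    simp only [inner_zero_right, zero_add] at h3
    exact h3
  have hpos (s : ℝ) : 0 < ∑ a, c (x + s • (y - x)) a * inner ℝ (p a) (y - x) ^ 2 := by
    obtain ⟨a, ha⟩ : ∃ a, inner ℝ (p a) (y - x) ≠ 0 := by
      by_contra! h
      exact hh (hp _ h)
    refine Finset.sum_pos' (fun b _ => mul_nonneg (hc _ b).le (sq_nonneg _))
      ⟨a, Finset.mem_univ a, mul_pos (hc _ a) (by positivity)⟩
  have hmono : StrictMono g := strictMono_of_deriv_pos fun s => (hder s).deriv ▸ hpos s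
  have := hmono zero_lt_one
  simp [hg, hxy] at this

end rankOneSum

section logSumExp

variable {n : ℕ} {κ : Type*} [Fintype κ] (v : κ → En n)

/-- The exponential sum `∑ k, exp ⟪v k, x⟫`. -/
def expSum (x : En n) : ℝ := ∑ k, Real.exp (inner ℝ (v k) x)

/-- The weights of the points `v k` under the exponential tilt by `x`. -/
def expWeight (k : κ) (x : En n) : ℝ := Real.exp (inner ℝ (v k) x) / expSum v x

/-- The barycentre of the points `v k` under the exponential tilt by `x`. -/
def expMean (x : En n) : En n := ∑ k, expWeight v k x • v k

theorem hasFDerivAt_exp_inner (u x : En n) :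
    HasFDerivAt (fun x => Real.exp (inner ℝ u x)) (Real.exp (inner ℝ u x) • innerSL ℝ u) x :=
  ((innerSL ℝ u).hasFDerivAt (x := x)).exp

theorem hasFDerivAt_expSum (x : En n) :
    HasFDerivAt (expSum v) (∑ k, Real.exp (inner ℝ (v k) x) • innerSL ℝ (v k)) x :=
  HasFDerivAt.fun_sum fun k _ => hasFDerivAt_exp_inner (v k) x

variable [Nonempty κ]

theorem expSum_pos (x : En n) : 0 < expSum v x :=
  Finset.sum_pos (fun _ _ => Real.exp_pos _) Finset.univ_nonempty

theorem expWeight_pos (k : κ) (x : En n) : 0 < expWeight v k x :=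
  div_pos (Real.exp_pos _) (expSum_pos v x)

theorem sum_expWeight (x : En n) : ∑ k, expWeight v k x = 1 := by
  simp only [expWeight, ← Finset.sum_div]
  exact div_self (expSum_pos v x).ne'

theorem expMean_mem_convexHull (x : En n) : expMean v x ∈ convexHull ℝ (Set.range v) :=
  (convex_convexHull ℝ _).sum_mem (fun k _ => (expWeight_pos v k x).le) (sum_expWeight v x)
    fun k _ => subset_convexHull ℝ _ ⟨k, rfl⟩

theorem hasFDerivAt_log_expSum (x : En n) :
    HasFDerivAt (fun x => Real.log (expSum v x)) (innerSL ℝ (expMean v x)) x := by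
  refine ((hasFDerivAt_expSum v x).log (expSum_pos v x).ne').congr_fderiv ?_
  simp only [expMean, map_sum, map_smul, Finset.smul_sum, smul_smul, expWeight, div_eq_inv_mul]

theorem inner_le_log_expSum {z : En n} (hz : z ∈ convexHull ℝ (Set.range v)) (x : En n) :
    inner ℝ z x ≤ Real.log (expSum v x) := by
  have hconv : Convex ℝ {z : En n | inner ℝ z x ≤ Real.log (expSum v x)} :=
    convex_halfSpace_le ⟨fun a b => inner_add_left a b x,
      fun c a => real_inner_smul_left a x c⟩ _
  refine convexHull_min ?_ hconv hz
  rintro _ ⟨k, rfl⟩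
  refine (Real.le_log_iff_exp_le (expSum_pos v x)).2 ?_
  exact Finset.single_le_sum (f := fun k => Real.exp (inner ℝ (v k) x))
    (fun _ _ => (Real.exp_pos _).le) (Finset.mem_univ k)

theorem hasFDerivAt_expWeight (k : κ) (x : En n) :
    HasFDerivAt (expWeight v k) (expWeight v k x • innerSL ℝ (v k - expMean v x)) x := by
  have h1 (x : En n) : expWeight v k x =
      Real.exp (inner ℝ (v k) x - Real.log (expSum v x)) := by
    rw [Real.exp_sub, Real.exp_log (expSum_pos v x), expWeight]
  have h2 := (((innerSL ℝ (v k)).hasFDerivAt (x := x)).fun_sub (hasFDerivAt_log_expSum v x)).exp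
  simp only [innerSL_apply_apply, ← h1] at h2
  exact h2.congr_fderiv (by rw [map_sub])

theorem continuous_expWeight (k : κ) : Continuous (expWeight v k) :=
  continuous_iff_continuousAt.2 fun x => (hasFDerivAt_expWeight v k x).continuousAt

theorem hasFDerivAt_expMean (x : En n) :
    HasFDerivAt (expMean v) (rankOneSum
      (fun a : κ × κ => expWeight v a.1 x * expWeight v a.2 x / 2)
      fun a => v a.1 - v a.2) x := by
  have h : HasFDerivAt (expMean v)
      (∑ k, (expWeight v k x • innerSL ℝ (v k - expMean v x)).smulRight (v k)) x :=
    HasFDerivAt.fun_sum fun k _ => (hasFDerivAt_expWeight v k x).smul_const (v k)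
  refine h.congr_fderiv (Eq.symm ?_)
  refine ContinuousLinearMap.ext fun h => ?_
  set w : κ → ℝ := fun k => expWeight v k x with hw
  have hmean (k : κ) : inner ℝ (v k - expMean v x) h = ∑ l, w l * inner ℝ (v k - v l) h := by
    simp only [inner_sub_left, mul_sub, Finset.sum_sub_distrib, ← Finset.sum_mul]
    rw [show ∑ l, w l = 1 from sum_expWeight v x, one_mul, expMean, sum_inner]
    simp only [real_inner_smul_left, hw]
  set S : En n := ∑ k, ∑ l, (w k * w l * inner ℝ (v k - v l) h) • v k with hS
  have hS' : S = ∑ k, ∑ l, -((w k * w l * inner ℝ (v k - v l) h) • v l) := by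
    rw [hS, Finset.sum_comm]
    refine Finset.sum_congr rfl fun k _ => Finset.sum_congr rfl fun l _ => ?_
    rw [← neg_smul, ← neg_sub (v k), inner_neg_left]
    congr 1
    ring
  have hR : (∑ k, (w k • innerSL ℝ (v k - expMean v x)).smulRight (v k)) h = S := by
    simp only [sum_apply, ContinuousLinearMap.smulRight_apply,
      smul_apply, innerSL_apply_apply, hmean, smul_eq_mul, hS,
      Finset.mul_sum, Finset.sum_smul, mul_assoc]
  rw [hR, rankOneSum_apply, Fintype.sum_prod_type]
  have h2 : S = (1 / 2 : ℝ) • (S + S) := by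
    rw [← two_smul ℝ S, smul_smul]
    norm_num
  rw [h2]
  nth_rewrite 2 [hS']
  rw [hS, ← Finset.sum_add_distrib, Finset.smul_sum]
  refine Finset.sum_congr rfl fun k _ => ?_
  rw [← Finset.sum_add_distrib, Finset.smul_sum]
  refine Finset.sum_congr rfl fun l _ => ?_
  rw [← sub_eq_add_neg, ← smul_sub, smul_smul]
  congr 1
  ring

end logSumExp

section polytope

variable {n m : ℕ} {κ : Type*} [Fintype κ] [Nonempty κ] (v : Fin m → κ → En n)

theorem hasFDerivAt_sum_smul_expMean (ε : Fin m → ℝ) (x : En n) :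
    HasFDerivAt (fun x => ∑ i, ε i • expMean (v i) x) (rankOneSum
      (fun a : Fin m × κ × κ =>
        ε a.1 * (expWeight (v a.1) a.2.1 x * expWeight (v a.1) a.2.2 x / 2))
      fun a => v a.1 a.2.1 - v a.1 a.2.2) x := by
  refine (HasFDerivAt.fun_sum (u := Finset.univ)
    fun i _ => (hasFDerivAt_expMean (v i) x).fun_const_smul (ε i)).congr_fderiv ?_
  simp only [rankOneSum, Fintype.sum_prod_type, Finset.smul_sum, smul_smul]

/-- Every interior point of the Minkowski combination is a value of the gradient map of the
log-Laplace potential. -/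
theorem interior_minkowskiComb_subset_range {ε : Fin m → ℝ} (hε : ∀ i, 0 < ε i) :
    interior (minkowskiComb ε fun i => convexHull ℝ (Set.range (v i))) ⊆
      Set.range fun x => ∑ i, ε i • expMean (v i) x := by
  intro q hq
  set F : En n → ℝ := fun x => ∑ i, ε i * Real.log (expSum (v i) x) - inner ℝ q x with hF
  have hder (x : En n) :
      HasFDerivAt F (innerSL ℝ (∑ i, ε i • expMean (v i) x - q)) x := by
    have h1 : HasFDerivAt (fun x => ∑ i, ε i * Real.log (expSum (v i) x))
        (∑ i, ε i • innerSL ℝ (expMean (v i) x)) x :=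
      HasFDerivAt.fun_sum fun i _ => (hasFDerivAt_log_expSum (v i) x).const_mul (ε i)
    refine (h1.fun_sub ((innerSL ℝ q).hasFDerivAt (x := x))).congr_fderiv ?_
    simp only [map_sub, map_sum, map_smul]
  have hcont : Continuous F :=
    continuous_iff_continuousAt.2 fun x => (hder x).continuousAt
  have hle {z : En n} (hz : z ∈ minkowskiComb ε fun i => convexHull ℝ (Set.range (v i)))
      (x : En n) : inner ℝ z x ≤ ∑ i, ε i * Real.log (expSum (v i) x) := by
    obtain ⟨y, hy, rfl⟩ := hz
    simp only [sum_inner, real_inner_smul_left]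
    exact Finset.sum_le_sum fun i _ =>
      mul_le_mul_of_nonneg_left (inner_le_log_expSum (v i) (hy i) x) (hε i).le
  obtain ⟨r, hr, hball⟩ := Metric.isOpen_iff.1 isOpen_interior q hq
  have hlow (x : En n) : r / 2 * ‖x‖ ≤ F x := by
    have hmem : q + (r / 2 * ‖x‖⁻¹) • x ∈ Metric.ball q r := by
      rw [mem_ball_iff_norm, add_sub_cancel_left, norm_smul, Real.norm_eq_abs,
        abs_of_nonneg (by positivity), mul_assoc]
      have : ‖x‖⁻¹ * ‖x‖ ≤ 1 := inv_mul_le_one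
      nlinarith
    have h := hle (interior_subset (hball hmem)) x
    rw [inner_add_left, real_inner_smul_left, real_inner_self_eq_norm_sq] at h
    have h2 : r / 2 * ‖x‖⁻¹ * ‖x‖ ^ 2 = r / 2 * ‖x‖ := by
      rcases eq_or_ne ‖x‖ 0 with h0 | h0
      · simp [h0]
      · field_simp
    simp only [hF]
    linarith
  have hcoer : Tendsto F (cocompact (En n)) atTop :=
    tendsto_atTop_mono hlow ((tendsto_norm_cocompact_atTop).const_mul_atTop (by positivity))
  obtain ⟨x, hx⟩ := hcont.exists_forall_le hcoer
  have h0 := IsLocalMin.hasFDerivAt_eq_zero (Eventually.of_forall hx) (hder x)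
  refine ⟨x, sub_eq_zero.1 (inner_self_eq_zero (𝕜 := ℝ).1 ?_)⟩
  exact congrArg (fun L : En n →L[ℝ] ℝ => L (∑ i, ε i • expMean (v i) x - q)) h0

theorem volume_minkowskiComb_eq_volume_range {ε : Fin m → ℝ} (hε : ∀ i, 0 < ε i) :
    volume (minkowskiComb ε fun i => convexHull ℝ (Set.range (v i))) =
      volume (Set.range fun x => ∑ i, ε i • expMean (v i) x) := by
  have hconv : Convex ℝ (minkowskiComb ε fun i => convexHull ℝ (Set.range (v i))) :=
    convex_minkowskiComb fun i => convex_convexHull ℝ _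
  refine le_antisymm ?_ (measure_mono ?_)
  · calc _ ≤ volume (interior (minkowskiComb ε fun i => convexHull ℝ (Set.range (v i))) ∪
          frontier (minkowskiComb ε fun i => convexHull ℝ (Set.range (v i)))) := by
          refine measure_mono ?_
          rw [← closure_eq_interior_union_frontier]
          exact subset_closure
      _ ≤ _ := measure_union_le _ _
      _ ≤ _ := by
          rw [hconv.addHaar_frontier volume, add_zero]
          exact measure_mono (interior_minkowskiComb_subset_range v hε)
  · rintro _ ⟨x, rfl⟩
    exact ⟨fun i => expMean (v i) x, fun i => expMean_mem_convexHull (v i) x, rfl⟩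

theorem isNonnegForm_volume_polytope :
    IsNonnegForm n fun ε => volume (minkowskiComb ε fun i => convexHull ℝ (Set.range (v i))) := by
  classical
  by_cases hdeg : ∃ h : En n, h ≠ 0 ∧ ∀ i k l, inner ℝ (v i k - v i l) h = 0
  · obtain ⟨h, h0, hh⟩ := hdeg
    exact IsNonnegForm.zero.congr fun ε _ => volume_minkowskiComb_eq_zero v h0 hh ε
  push Not at hdeg
  set w : En n → Fin m × κ × κ → ℝ := fun x a =>
    expWeight (v a.1) a.2.1 x * expWeight (v a.1) a.2.2 x / 2 with hw
  have hwpos (x : En n) (a : Fin m × κ × κ) : 0 < w x a :=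
    half_pos (mul_pos (expWeight_pos _ _ _) (expWeight_pos _ _ _))
  have hwcont (a : Fin m × κ × κ) : Continuous fun x => w x a :=
    ((continuous_expWeight _ _).mul (continuous_expWeight _ _)).div_const _
  set p : Fin m × κ × κ → En n := fun a => v a.1 a.2.1 - v a.1 a.2.2 with hp
  set D : (Fin n → Fin m × κ × κ) → En n → ℝ := fun s x =>
    (∏ j, w x (s j)) * ((Matrix.of fun j k => p (s j) k).det ^ 2 / n.factorial) with hD
  have hDnn (s : Fin n → Fin m × κ × κ) (x : En n) : 0 ≤ D s x :=
    mul_nonneg (Finset.prod_nonneg fun j _ => (hwpos x _).le) (by positivity)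
  have hDcont (s : Fin n → Fin m × κ × κ) : Continuous (D s) :=
    (continuous_finsetProd _ fun j _ => hwcont (s j)).mul continuous_const
  refine ⟨fun i => ∑ s with (fun j => (s j).1) = i, ∫⁻ x, ENNReal.ofReal (D s x),
    fun ε hε => ?_⟩
  have hinj : Function.Injective fun x => ∑ i, ε i • expMean (v i) x :=
    injective_of_hasFDerivAt_rankOneSum (hasFDerivAt_sum_smul_expMean v ε)
      (fun x a => mul_pos (hε a.1) (hwpos x a)) fun h hh => by
        by_contra h0
        obtain ⟨i, k, l, hne⟩ := hdeg h h0
        exact hne (hh (i, k, l))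
  have hdet (x : En n) : (rankOneSum (fun a => ε a.1 * w x a) p).det =
      ∑ s : Fin n → Fin m × κ × κ, (∏ j, ε (s j).1) * D s x := by
    rw [det_rankOneSum]
    refine Finset.sum_congr rfl fun s _ => ?_
    rw [Finset.prod_mul_distrib, mul_assoc]
  have hterm (s : Fin n → Fin m × κ × κ) (x : En n) : 0 ≤ (∏ j, ε (s j).1) * D s x :=
    mul_nonneg (Finset.prod_nonneg fun j _ => (hε _).le) (hDnn s x)
  have hofReal (x : En n) : ENNReal.ofReal |(rankOneSum (fun a => ε a.1 * w x a) p).det| =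
      ∑ s : Fin n → Fin m × κ × κ,
        (∏ j, ENNReal.ofReal (ε (s j).1)) * ENNReal.ofReal (D s x) := by
    rw [hdet, abs_of_nonneg (Finset.sum_nonneg fun s _ => hterm s x),
      ENNReal.ofReal_sum_of_nonneg fun s _ => hterm s x]
    refine Finset.sum_congr rfl fun s _ => ?_
    rw [ENNReal.ofReal_mul (Finset.prod_nonneg fun j _ => (hε _).le),
      ENNReal.ofReal_prod_of_nonneg fun j _ => (hε _).le]
  have hmeas (s : Fin n → Fin m × κ × κ) : Measurable fun x => ENNReal.ofReal (D s x) :=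
    (hDcont s).measurable.ennreal_ofReal
  beta_reduce
  rw [volume_minkowskiComb_eq_volume_range v hε, ← Set.image_univ,
    ← lintegral_abs_det_fderiv_eq_addHaar_image volume MeasurableSet.univ
      (fun x _ => (hasFDerivAt_sum_smul_expMean v ε x).hasFDerivWithinAt) hinj.injOn,
    Measure.restrict_univ]
  calc ∫⁻ x, ENNReal.ofReal |(rankOneSum (fun a => ε a.1 * w x a) p).det|
      = ∑ s : Fin n → Fin m × κ × κ,
          (∏ j, ENNReal.ofReal (ε (s j).1)) * ∫⁻ x, ENNReal.ofReal (D s x) := by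
        simp only [hofReal]
        rw [lintegral_finsetSum _ fun s _ => (hmeas s).const_mul _]
        exact Finset.sum_congr rfl fun s _ => lintegral_const_mul _ (hmeas s)
    _ = _ := by
        rw [← Finset.sum_fiberwise _ fun s : Fin n → Fin m × κ × κ => fun j => (s j).1]
        refine Finset.sum_congr rfl fun i _ => ?_
        rw [Finset.mul_sum]
        refine Finset.sum_congr rfl fun s hs => ?_
        rw [← (Finset.mem_filter.1 hs).2]

end polytope

theorem stmt2 (n m : ℕ) (hn : 1 ≤ n) (hm : 1 ≤ m)
    (f : Fin m → En n → ℝ≥0∞) (hf : ∀ i, QC (f i)) :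
    ∃ c : (Fin n → Fin m) → ℝ≥0∞,
      (∀ (i : Fin n → Fin m) (σ : Equiv.Perm (Fin n)), c (i ∘ σ) = c i) ∧
      ∀ ε : Fin m → ℝ, (∀ i, 0 < ε i) →
        ∫⁻ x, oplusMany (fun i => odot (ε i) (f i)) x =
          ∑ i : Fin n → Fin m, (∏ j, ENNReal.ofReal (ε (i j))) * c i := by
  refine IsNonnegForm.exists_symmetric
    (V := fun ε => ∫⁻ x, oplusMany (fun i => odot (ε i) (f i)) x) ?_
  have hconv (t : ℝ≥0∞) (i : Fin m) : Convex ℝ {z | t < f i z} := (hf i).2.1.convex_superlevel t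
  refine IsNonnegForm.of_tendsto
    (V := fun k ε => ∑ j ∈ Finset.range ((k + 1) * (k + 1)), ((k + 1 : ℕ) : ℝ≥0∞)⁻¹ *
      volume (minkowskiComb ε fun i => {z | (j + 1 : ℕ) * ((k + 1 : ℕ) : ℝ≥0∞)⁻¹ < f i z}))
    (fun k => IsNonnegForm.sum _ fun j => IsNonnegForm.const_mul
      (isNonnegForm_volume_minkowskiComb_of_polytope
        (fun _ v => isNonnegForm_volume_polytope v) (hconv _)) _)
    fun ε hε => ?_
  simp only [← superlevel_oplusMany_odot hm f hε]
  refine tendsto_sum_measure_superlevel _ _ fun t => ?_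
  rw [superlevel_oplusMany_odot hm f hε]
  exact (convex_minkowskiComb (hconv t)).nullMeasurableSet volume
end
end

section
/- Let n ≥ 1, f₁, …, f_m ∈ QC(ℝⁿ) and ε₁, …, ε_m > 0. Then ∫_{ℝⁿ} ((ε₁ ⊙ f₁) ⊕ ⋯ ⊕ (ε_m ⊙ f_m))(x) dx = ∫₀^∞ vol( ε₁·{f₁ ≥ t} + ε₂·{f₂ ≥ t} + ⋯ + ε_m·{f_m ≥ t} ) dt, where vol is Lebesgue measure on ℝⁿ, + denotes Minkowski sum of sets, and both sides take values in [0,∞]. -/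
open MeasureTheory ENNReal Filter Topology Pointwise

noncomputable section

theorem IsSigmaCompact.measurableSet {X : Type*} [TopologicalSpace X] [T2Space X]
    [MeasurableSpace X] [BorelSpace X] {s : Set X} (hs : IsSigmaCompact s) : MeasurableSet s := by
  obtain ⟨K, hK, rfl⟩ := hs
  exact MeasurableSet.iUnion fun k => (hK k).measurableSet

/-- The layer cake formula for a measurable `ℝ≥0∞`-valued function, with strict superlevel sets. -/
theorem lintegral_eq_lintegral_meas_ofReal_lt {X : Type*} [MeasurableSpace X] (μ : Measure X)
    [SFinite μ] {F : X → ℝ≥0∞} (hF : Measurable F) :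
    ∫⁻ x, F x ∂μ = ∫⁻ t in Set.Ioi (0 : ℝ), μ {x | ENNReal.ofReal t < F x} := by
  have hS : MeasurableSet {p : X × ℝ | ENNReal.ofReal p.2 < F p.1} :=
    measurableSet_lt (by fun_prop) (by fun_prop)
  have h := (Measure.prod_apply (μ := μ) (ν := volume.restrict (Set.Ioi (0 : ℝ))) hS).symm.trans
    (Measure.prod_apply_symm hS)
  simp only [Set.preimage_ofPred_eq] at h
  rw [← h]
  refine lintegral_congr fun x => ?_
  rw [Measure.restrict_apply' measurableSet_Ioi]
  rcases eq_or_ne (F x) ∞ with hx | hx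
  · have : {t : ℝ | ENNReal.ofReal t < F x} ∩ Set.Ioi 0 = Set.Ioi 0 := by
      ext t; simp [hx]
    rw [this, hx, Real.volume_Ioi]
  · have : {t : ℝ | ENNReal.ofReal t < F x} ∩ Set.Ioi 0 = Set.Ioo 0 (F x).toReal := by
      ext t
      simp only [Set.mem_inter_iff, Set.mem_ofPred_eq, Set.mem_Ioi, Set.mem_Ioo]
      constructor
      · rintro ⟨h1, h2⟩
        exact ⟨h2, (ENNReal.ofReal_lt_iff_lt_toReal h2.le hx).1 h1⟩
      · rintro ⟨h2, h1⟩
        exact ⟨(ENNReal.ofReal_lt_iff_lt_toReal h2.le hx).2 h1, h2⟩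
    rw [this, Real.volume_Ioo, sub_zero, ENNReal.ofReal_toReal hx]

/-- The layer cake formula for a measurable `ℝ≥0∞`-valued function, with superlevel sets. -/
theorem lintegral_eq_lintegral_meas_ofReal_le {X : Type*} [MeasurableSpace X] (μ : Measure X)
    [SFinite μ] {F : X → ℝ≥0∞} (hF : Measurable F) :
    ∫⁻ x, F x ∂μ = ∫⁻ t in Set.Ioi (0 : ℝ), μ {x | ENNReal.ofReal t ≤ F x} := by
  have hS : MeasurableSet {p : X × ℝ | ENNReal.ofReal p.2 ≤ F p.1} :=
    measurableSet_le (by fun_prop) (by fun_prop)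
  have h := (Measure.prod_apply (μ := μ) (ν := volume.restrict (Set.Ioi (0 : ℝ))) hS).symm.trans
    (Measure.prod_apply_symm hS)
  simp only [Set.preimage_ofPred_eq] at h
  rw [← h]
  refine lintegral_congr fun x => ?_
  rw [Measure.restrict_apply' measurableSet_Ioi]
  rcases eq_or_ne (F x) ∞ with hx | hx
  · have : {t : ℝ | ENNReal.ofReal t ≤ F x} ∩ Set.Ioi 0 = Set.Ioi 0 := by
      ext t; simp [hx]
    rw [this, hx, Real.volume_Ioi]
  · have : {t : ℝ | ENNReal.ofReal t ≤ F x} ∩ Set.Ioi 0 = Set.Ioc 0 (F x).toReal := by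
      ext t
      simp only [Set.mem_inter_iff, Set.mem_ofPred_eq, Set.mem_Ioi, Set.mem_Ioc,
        ENNReal.ofReal_le_iff_le_toReal hx]
      exact and_comm
    rw [this, Real.volume_Ioc, sub_zero, ENNReal.ofReal_toReal hx]

/-- The Minkowski sum of the superlevel sets `{gᵢ ≥ s}`. -/
def sumSuperlevel {n m : ℕ} (g : Fin m → En n → ℝ≥0∞) (s : ℝ≥0∞) : Set (En n) :=
  (fun y : Fin m → En n => ∑ i, y i) '' {y | ∀ i, s ≤ g i (y i)}

theorem le_oplusMany_of_mem_sumSuperlevel {n m : ℕ} {g : Fin m → En n → ℝ≥0∞} {s : ℝ≥0∞}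
    {x : En n} (hx : x ∈ sumSuperlevel g s) : s ≤ oplusMany g x := by
  obtain ⟨y, hy, hyx⟩ := hx
  exact le_iSup₂_of_le y hyx (le_iInf hy)

theorem mem_sumSuperlevel_of_lt_oplusMany {n m : ℕ} {g : Fin m → En n → ℝ≥0∞} {s : ℝ≥0∞}
    {x : En n} (hx : s < oplusMany g x) : x ∈ sumSuperlevel g s := by
  obtain ⟨y, hyx, hy⟩ := by simpa only [oplusMany, lt_iSup_iff, exists_prop] using hx
  exact ⟨y, fun i => hy.le.trans (iInf_le _ i), hyx⟩

theorem measurableSet_sumSuperlevel {n m : ℕ} {g : Fin m → En n → ℝ≥0∞}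
    (hg : ∀ i, UpperSemicontinuous (g i)) (s : ℝ≥0∞) : MeasurableSet (sumSuperlevel g s) := by
  have hclosed : IsClosed {y : Fin m → En n | ∀ i, s ≤ g i (y i)} := by
    rw [Set.ofPred_forall]
    exact isClosed_iInter fun i => ((hg i).comp (continuous_apply i)).isClosed_preimage s
  exact ((isSigmaCompact_univ.of_isClosed_subset hclosed (Set.subset_univ _)).image
    (by fun_prop)).measurableSet

theorem measurable_oplusMany {n m : ℕ} {g : Fin m → En n → ℝ≥0∞}
    (hg : ∀ i, UpperSemicontinuous (g i)) : Measurable (oplusMany g) := by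
  refine measurable_of_Ioi fun a => ?_
  have : oplusMany g ⁻¹' Set.Ioi a =
      ⋃ (q : ℚ) (_ : a < ENNReal.ofReal q), sumSuperlevel g (ENNReal.ofReal q) := by
    ext x
    simp only [Set.mem_preimage, Set.mem_Ioi, Set.mem_iUnion, exists_prop]
    constructor
    · intro h
      obtain ⟨q, -, h1, h2⟩ := ENNReal.lt_iff_exists_rat_btwn.1 h
      exact ⟨q, h1, mem_sumSuperlevel_of_lt_oplusMany h2⟩
    · rintro ⟨q, h1, h2⟩
      exact h1.trans_le (le_oplusMany_of_mem_sumSuperlevel h2)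
  rw [this]
  exact MeasurableSet.iUnion fun q => MeasurableSet.iUnion fun _ =>
    measurableSet_sumSuperlevel hg _

theorem lintegral_oplusMany {n m : ℕ} {g : Fin m → En n → ℝ≥0∞}
    (hg : ∀ i, UpperSemicontinuous (g i)) :
    ∫⁻ x, oplusMany g x =
      ∫⁻ t in Set.Ioi (0 : ℝ), volume (sumSuperlevel g (ENNReal.ofReal t)) := by
  apply le_antisymm
  · rw [lintegral_eq_lintegral_meas_ofReal_lt _ (measurable_oplusMany hg)]
    exact lintegral_mono fun t => measure_mono fun x => mem_sumSuperlevel_of_lt_oplusMany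
  · rw [lintegral_eq_lintegral_meas_ofReal_le _ (measurable_oplusMany hg)]
    exact lintegral_mono fun t => measure_mono fun x => le_oplusMany_of_mem_sumSuperlevel

theorem sumSuperlevel_odot {n m : ℕ} (f : Fin m → En n → ℝ≥0∞) {ε : Fin m → ℝ}
    (hε : ∀ i, ε i ≠ 0) (s : ℝ≥0∞) :
    sumSuperlevel (fun i => odot (ε i) (f i)) s = ∑ i, ε i • {x | s ≤ f i x} := by
  ext x
  simp only [sumSuperlevel, odot, Set.mem_image, Set.mem_ofPred_eq, Set.mem_fintype_sum,
    Set.mem_smul_set_iff_inv_smul_mem₀ (hε _), exists_prop]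

theorem stmt3 (n m : ℕ) (hn : 1 ≤ n) (hm : 1 ≤ m)
    (f : Fin m → En n → ℝ≥0∞) (hf : ∀ i, QC (f i))
    (ε : Fin m → ℝ) (hε : ∀ i, 0 < ε i) :
    ∫⁻ x, oplusMany (fun i => odot (ε i) (f i)) x =
      ∫⁻ t in Set.Ioi (0 : ℝ),
        volume (∑ i : Fin m, ε i • {x : En n | ENNReal.ofReal t ≤ f i x}) := by
  have husc : ∀ i, UpperSemicontinuous (odot (ε i) (f i)) := fun i =>
    (hf i).1.comp (continuous_const_smul _)
  simp only [lintegral_oplusMany husc, sumSuperlevel_odot f fun i => (hε i).ne']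
end
end

section
/- Let n ≥ 1 and let f ∈ QC(ℝⁿ) satisfy f(x) ≤ 1 for all x. For ε > 0 let f_ε(x) = sup_{|y| ≤ ε} f(x+y). Then f_ε = f ⊕ (ε ⊙ 1_D), where 1_D is the indicator function of the closed Euclidean unit ball D, and there exist W₀, W₁, …, Wₙ ∈ [0,∞] such that ∫_{ℝⁿ} f_ε = ∑_{i=0}^{n} binom(n,i) Wᵢ εⁱ for every ε > 0, with W₀ = ∫_{ℝⁿ} f. -/
open MeasureTheory ENNReal Filter Topology

noncomputable section

def oplus {n : ℕ} (f g : En n → ℝ≥0∞) : En n → ℝ≥0∞ :=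
  fun x => ⨆ y : En n, min (f y) (g (x - y))

/-- `f_ε(x) = sup_{|y| ≤ ε} f (x + y)`. -/
def feps {n : ℕ} (f : En n → ℝ≥0∞) (ε : ℝ) : En n → ℝ≥0∞ :=
  fun x => ⨆ (y : En n) (_ : ‖y‖ ≤ ε), f (x + y)

/-- The indicator function of the closed Euclidean unit ball. -/
def indD {n : ℕ} : En n → ℝ≥0∞ := fun x => if ‖x‖ ≤ 1 then 1 else 0

section Steiner

open scoped Pointwise

/-- The function `x ↦ sup_{y ∈ A} f (x + y)`. -/
def supOver {n : ℕ} (A : Set (En n)) (f : En n → ℝ≥0∞) : En n → ℝ≥0∞ :=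
  fun x => ⨆ y ∈ A, f (x + y)

theorem feps_eq_supOver {n : ℕ} (f : En n → ℝ≥0∞) (ε : ℝ) :
    feps f ε = supOver (Metric.closedBall 0 ε) f := by
  ext x
  simp [feps, supOver]

theorem lt_supOver_iff {n : ℕ} {A : Set (En n)} {f : En n → ℝ≥0∞} {x : En n} {c : ℝ≥0∞} :
    c < supOver A f x ↔ ∃ y ∈ A, c < f (x + y) := by
  simp [supOver, lt_iSup_iff]

theorem le_supOver {n : ℕ} {A : Set (En n)} (f : En n → ℝ≥0∞) (x : En n) {y : En n}
    (hy : y ∈ A) : f (x + y) ≤ supOver A f x :=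
  le_iSup₂ (f := fun y (_ : y ∈ A) => f (x + y)) y hy

theorem supOver_le {n : ℕ} {A : Set (En n)} {f : En n → ℝ≥0∞} {x : En n} {c : ℝ≥0∞}
    (h : ∀ y ∈ A, f (x + y) ≤ c) : supOver A f x ≤ c :=
  iSup₂_le h

theorem supOver_mono {n : ℕ} {A B : Set (En n)} (h : A ⊆ B) (f : En n → ℝ≥0∞) (x : En n) :
    supOver A f x ≤ supOver B f x :=
  supOver_le fun _ hy => le_supOver f x (h hy)

theorem supOver_zero {n : ℕ} (f : En n → ℝ≥0∞) : supOver 0 f = f := by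
  ext x
  simp [supOver]

theorem supOver_add {n : ℕ} (A B : Set (En n)) (f : En n → ℝ≥0∞) :
    supOver (A + B) f = supOver B (supOver A f) := by
  ext x
  apply le_antisymm
  · refine supOver_le fun y hy => ?_
    obtain ⟨a, ha, b, hb, rfl⟩ := Set.mem_add.1 hy
    calc f (x + (a + b)) = f (x + b + a) := by congr 1; abel
      _ ≤ supOver A f (x + b) := le_supOver f _ ha
      _ ≤ _ := le_supOver _ x hb
  · refine supOver_le fun b hb => supOver_le fun a ha => ?_
    calc f (x + b + a) = f (x + (a + b)) := by congr 1; abel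
      _ ≤ _ := le_supOver f x (Set.add_mem_add ha hb)

theorem upperSemicontinuous_supOver {n : ℕ} {A : Set (En n)} (hA : IsCompact A)
    {f : En n → ℝ≥0∞} (hf : UpperSemicontinuous f) : UpperSemicontinuous (supOver A f) := by
  intro x c hc
  obtain ⟨c', hc', hcc⟩ := exists_between hc
  have hopen : IsOpen {p : En n × En n | f (p.1 + p.2) < c'} :=
    (upperSemicontinuous_iff_isOpen_preimage.1 hf c').preimage
      (continuous_fst.add continuous_snd)
  obtain ⟨U, V, hU, _, hxU, hAV, hUV⟩ := generalized_tube_lemma (s := {x}) isCompact_singleton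
    hA hopen (by
      rintro ⟨a, y⟩ ⟨rfl, hy⟩
      exact (le_supOver f a hy).trans_lt hc')
  filter_upwards [hU.mem_nhds (hxU rfl)] with z hz
  exact (supOver_le fun y hy => (hUV (Set.mk_mem_prod hz (hAV hy)) : f (z + y) < c').le).trans_lt
    hcc

theorem quasiConcave_supOver {n : ℕ} {A : Set (En n)} (hA : Convex ℝ A)
    {f : En n → ℝ≥0∞} (hf : QuasiConcave f) : QuasiConcave (supOver A f) := by
  intro x y l hl hl1
  refine le_of_forall_lt fun c hc => ?_
  rw [lt_min_iff, lt_supOver_iff, lt_supOver_iff] at hc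
  obtain ⟨⟨a, ha, hca⟩, b, hb, hcb⟩ := hc
  refine lt_supOver_iff.2 ⟨l • a + (1 - l) • b, hA ha hb hl.le (by linarith) (by ring), ?_⟩
  refine (lt_min hca hcb).trans_le ((hf _ _ l hl hl1).trans_eq ?_)
  congr 1
  simp only [smul_add]
  abel

/-- The segment from `0` to `t • u`. -/
def raySeg {n : ℕ} (u : En n) (t : ℝ) : Set (En n) := (fun r : ℝ => r • u) '' Set.Icc 0 t

theorem isCompact_raySeg {n : ℕ} (u : En n) (t : ℝ) : IsCompact (raySeg u t) :=
  isCompact_Icc.image (by fun_prop)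

theorem convex_raySeg {n : ℕ} (u : En n) (t : ℝ) : Convex ℝ (raySeg u t) :=
  (convex_Icc (0 : ℝ) t).linear_image (LinearMap.toSpanSingleton ℝ (En n) u)

theorem raySeg_zero {n : ℕ} (u : En n) : raySeg u 0 = 0 := by
  simp [raySeg, Set.singleton_zero]

theorem raySeg_mono {n : ℕ} (u : En n) {s t : ℝ} (h : s ≤ t) : raySeg u s ⊆ raySeg u t :=
  Set.image_mono (Set.Icc_subset_Icc_right h)

theorem supOver_raySeg_add {n : ℕ} (g : En n → ℝ≥0∞) (u x : En n) {s t : ℝ} (hs : 0 ≤ s)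
    (ht : 0 ≤ t) :
    supOver (raySeg u (s + t)) g x =
      max (supOver (raySeg u s) g x) (supOver (raySeg u t) g (x + s • u)) := by
  apply le_antisymm
  · refine supOver_le ?_
    rintro _ ⟨r, ⟨hr0, hr⟩, rfl⟩
    rcases le_total r s with h | h
    · exact le_max_of_le_left (le_supOver g x ⟨r, ⟨hr0, h⟩, rfl⟩)
    · refine le_max_of_le_right ?_
      have : x + r • u = x + s • u + (r - s) • u := by rw [sub_smul]; abel
      simp only [this]
      exact le_supOver g _ ⟨r - s, ⟨by linarith, by linarith⟩, rfl⟩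
  · refine max_le (supOver_mono (raySeg_mono u (by linarith)) g x) (supOver_le ?_)
    rintro _ ⟨r, ⟨hr0, hr⟩, rfl⟩
    have : x + s • u + r • u = x + (s + r) • u := by rw [add_smul]; abel
    simp only [this]
    exact le_supOver g _ ⟨s + r, ⟨by linarith, by linarith⟩, rfl⟩

theorem min_supOver_raySeg {n : ℕ} {g : En n → ℝ≥0∞} (hg : QuasiConcave g)
    (u x : En n) {s t : ℝ} (hs : 0 ≤ s) (ht : 0 ≤ t) :
    min (supOver (raySeg u s) g x) (supOver (raySeg u t) g (x + s • u)) = g (x + s • u) := by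
  apply le_antisymm
  · refine le_of_forall_lt fun c hc => ?_
    rw [lt_min_iff, lt_supOver_iff, lt_supOver_iff] at hc
    obtain ⟨⟨_, ⟨a, ⟨ha0, ha⟩, rfl⟩, hca⟩, _, ⟨b, ⟨hb0, hb⟩, rfl⟩, hcb⟩ := hc
    simp only at hca hcb
    rcases hb0.eq_or_lt with rfl | hb0
    · simpa using hcb
    rcases ha.eq_or_lt with rfl | ha
    · exact hca
    have hd : 0 < s + b - a := by linarith
    refine (lt_min hca hcb).trans_le
      ((hg _ _ (b / (s + b - a)) (by positivity) ((div_lt_one hd).2 (by linarith))).trans_eq ?_)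
    congr 1
    have h1 : 1 - b / (s + b - a) = (s - a) / (s + b - a) := by field_simp; ring
    rw [h1]
    match_scalars <;> field_simp <;> ring
  · refine le_min (le_supOver g x ⟨s, ⟨hs, le_rfl⟩, rfl⟩) ?_
    simpa using le_supOver g (x + s • u) (y := 0) (A := raySeg u t) ⟨0, ⟨le_rfl, ht⟩, by simp⟩

theorem lintegral_supOver_raySeg_add {n : ℕ} {g : En n → ℝ≥0∞} (hg : QuasiConcave g)
    (hgu : UpperSemicontinuous g) (u : En n) {s t : ℝ} (hs : 0 ≤ s) (ht : 0 ≤ t) :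
    (∫⁻ x, supOver (raySeg u (s + t)) g x) + ∫⁻ x, g x =
      (∫⁻ x, supOver (raySeg u s) g x) + ∫⁻ x, supOver (raySeg u t) g x := by
  have hm : ∀ t, Measurable (supOver (raySeg u t) g) := fun t =>
    (upperSemicontinuous_supOver (isCompact_raySeg u t) hgu).measurable
  rw [← lintegral_add_right_eq_self g (s • u),
    ← lintegral_add_right_eq_self (supOver (raySeg u t) g) (s • u),
    ← lintegral_add_left (hm _), ← lintegral_add_left (hm _)]
  refine lintegral_congr fun x => ?_
  rw [supOver_raySeg_add g u x hs ht, ← min_supOver_raySeg hg u x hs ht, max_add_min]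

theorem affine_of_monotone_of_additive {φ : ℝ → ℝ} (hmono : MonotoneOn φ (Set.Ici 0))
    (hadd : ∀ s t, 0 ≤ s → 0 ≤ t → φ (s + t) + φ 0 = φ s + φ t) {t : ℝ} (ht : 0 ≤ t) :
    φ t = φ 0 + t * (φ 1 - φ 0) := by
  have hnat : ∀ (r : ℝ), 0 ≤ r → ∀ k : ℕ, φ (k * r) - φ 0 = k * (φ r - φ 0) := by
    intro r hr k
    induction k with
    | zero => simp
    | succ k ih =>
      have h := hadd (k * r) r (by positivity) hr
      push_cast
      rw [add_one_mul (k : ℝ) r]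
      linarith
  have hbound : ∀ k : ℕ, k * |(φ t - φ 0) - t * (φ 1 - φ 0)| ≤ φ 1 - φ 0 := by
    intro k
    have hk := hnat t ht k
    have hkt : (0 : ℝ) ≤ k * t := by positivity
    have hl : (⌊k * t⌋₊ : ℝ) ≤ k * t := Nat.floor_le hkt
    have hu : k * t ≤ ((⌊k * t⌋₊ + 1 : ℕ) : ℝ) := by
      push_cast
      exact (Nat.lt_floor_add_one _).le
    have h1 := hmono (a := ⌊k * t⌋₊) (by simp) hkt hl
    have h2 := hmono (b := ((⌊k * t⌋₊ + 1 : ℕ) : ℝ)) hkt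
      (Set.mem_Ici.2 (Nat.cast_nonneg _)) hu
    have h3 := hnat 1 zero_le_one ⌊k * t⌋₊
    have h4 := hnat 1 zero_le_one (⌊k * t⌋₊ + 1)
    have h5 : φ 0 ≤ φ 1 := hmono (by simp) (by simp) zero_le_one
    rw [mul_one] at h3 h4
    push_cast at h2 h4 hu
    have hk0 : (0 : ℝ) ≤ k := k.cast_nonneg
    have habs : (k : ℝ) * |φ t - φ 0 - t * (φ 1 - φ 0)| =
        |(k : ℝ) * (φ t - φ 0 - t * (φ 1 - φ 0))| := by rw [abs_mul, abs_of_nonneg hk0]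
    rw [habs, abs_le]
    constructor <;> nlinarith
  have h5 : |(φ t - φ 0) - t * (φ 1 - φ 0)| ≤ 0 := by
    by_contra! h
    obtain ⟨k, hk⟩ := exists_nat_gt ((φ 1 - φ 0) / |(φ t - φ 0) - t * (φ 1 - φ 0)|)
    rw [div_lt_iff₀ h] at hk
    linarith [hbound k]
  have := abs_nonpos_iff.1 h5
  linarith

/-- Functionals which are nonnegative on compact convex sets and affine under adding multiples of
a segment. -/
def IsRayAffine {n : ℕ} (Φ : Set (En n) → ℝ) : Prop :=
  ∀ K, IsCompact K → Convex ℝ K → 0 ≤ Φ K ∧ ∀ u t, 0 ≤ t →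
    Φ (K + raySeg u t) = Φ K + t * (Φ (K + raySeg u 1) - Φ K)

theorem IsRayAffine.sub {n : ℕ} {Φ : Set (En n) → ℝ} (h : IsRayAffine Φ) (v : En n) :
    IsRayAffine fun K => Φ (K + raySeg v 1) - Φ K := by
  intro K hK hKc
  refine ⟨?_, fun u t ht => ?_⟩
  · by_contra! hneg
    obtain ⟨hK0, hKa⟩ := h K hK hKc
    set d := Φ (K + raySeg v 1) - Φ K with hd
    have ht : 0 ≤ (Φ K + 1) / (-d) := div_nonneg (by linarith) (by linarith)
    have h1 := (h _ (hK.add (isCompact_raySeg v _)) (hKc.add (convex_raySeg v _))).1.trans_eq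
      (hKa v _ ht)
    rw [← hd, div_mul_eq_mul_div, mul_div_assoc, div_neg, div_self hneg.ne] at h1
    linarith
  · have h1 := (h K hK hKc).2 u t ht
    have h2 := (h _ (hK.add (isCompact_raySeg v 1)) (hKc.add (convex_raySeg v 1))).2 u t ht
    simp only [add_right_comm K (raySeg u _) (raySeg v 1)]
    rw [h1, h2]
    ring

theorem isCompact_sum_raySeg {n : ℕ} {ι : Type*} (s : Finset ι) (u : ι → En n) (t : ℝ) :
    IsCompact (∑ i ∈ s, raySeg (u i) t) :=
  Finset.sum_induction _ IsCompact (fun _ _ => IsCompact.add) isCompact_singleton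
    fun _ _ => isCompact_raySeg _ _

theorem convex_sum_raySeg {n : ℕ} {ι : Type*} (s : Finset ι) (u : ι → En n) (t : ℝ) :
    Convex ℝ (∑ i ∈ s, raySeg (u i) t) :=
  Finset.sum_induction _ (Convex ℝ) (fun _ _ => Convex.add) (convex_singleton 0)
    fun _ _ => convex_raySeg _ _

theorem IsRayAffine.exists_polynomial {n : ℕ} {ι : Type*} (s : Finset ι) (u : ι → En n) :
    ∀ {Φ : Set (En n) → ℝ}, IsRayAffine Φ → ∀ K, IsCompact K → Convex ℝ K →
      ∃ p : Polynomial ℝ, (∀ i, 0 ≤ p.coeff i) ∧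
        ∀ ε, 0 ≤ ε → Φ (K + ∑ i ∈ s, raySeg (u i) ε) = p.eval ε := by
  classical
  induction s using Finset.induction_on with
  | empty =>
    intro Φ h K hK hKc
    refine ⟨Polynomial.C (Φ K), fun i => ?_, by simp⟩
    rw [Polynomial.coeff_C]
    split_ifs
    exacts [(h K hK hKc).1, le_rfl]
  | insert j s hj ih =>
    intro Φ h K hK hKc
    obtain ⟨p, hp, hpe⟩ := ih h K hK hKc
    obtain ⟨q, hq, hqe⟩ := ih (h.sub (u j)) K hK hKc
    refine ⟨p + Polynomial.X * q, fun i => ?_, fun ε hε => ?_⟩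
    · rw [Polynomial.coeff_add]
      refine add_nonneg (hp i) ?_
      cases i with
      | zero => simp
      | succ i => simpa using hq i
    · rw [Finset.sum_insert hj, add_comm (raySeg (u j) ε), ← add_assoc,
        (h _ (hK.add (isCompact_sum_raySeg s u ε)) (hKc.add (convex_sum_raySeg s u ε))).2 _ _ hε,
        hqe ε hε, hpe ε hε]
      simp

theorem isRayAffine_lintegral_supOver {n : ℕ} {f : En n → ℝ≥0∞} (hf : QuasiConcave f)
    (hfu : UpperSemicontinuous f)
    (hfin : ∀ K : Set (En n), IsCompact K → ∫⁻ x, supOver K f x ≠ ∞) :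
    IsRayAffine fun K : Set (En n) => (∫⁻ x, supOver K f x).toReal := by
  intro K hK hKc
  refine ⟨ENNReal.toReal_nonneg, fun u t ht => ?_⟩
  have hg := quasiConcave_supOver hKc hf
  have hgu := upperSemicontinuous_supOver hK hfu
  have hfin' : ∀ t, ∫⁻ x, supOver (raySeg u t) (supOver K f) x ≠ ∞ := fun t => by
    rw [← supOver_add]
    exact hfin _ (hK.add (isCompact_raySeg u t))
  have key := affine_of_monotone_of_additive
    (φ := fun t => (∫⁻ x, supOver (raySeg u t) (supOver K f) x).toReal)
    (fun a _ b _ hab => ENNReal.toReal_mono (hfin' b)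
      (lintegral_mono fun x => supOver_mono (raySeg_mono u hab) _ x))
    (fun a b ha hb => by
      have := lintegral_supOver_raySeg_add hg hgu u ha hb
      simp only [raySeg_zero, supOver_zero]
      rw [← ENNReal.toReal_add (hfin' _) (hfin K hK), ← ENNReal.toReal_add (hfin' _) (hfin' _),
        this]) ht
  simpa only [supOver_add, raySeg_zero, supOver_zero] using key

theorem exists_int_lattice_sub_norm_le {n : ℕ} {r : ℝ} (hr : 0 < r) (k : ℕ) {y : En n}
    (hy : ‖y‖ ≤ k * r) :
    ∃ z ∈ Fintype.piFinset (fun _ : Fin n => Finset.Icc (-(k : ℤ)) k),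
      ‖y - WithLp.toLp 2 (fun i => r * (z i : ℝ))‖ ≤ r * √n := by
  refine ⟨fun i => ⌊y i / r⌋, ?_, ?_⟩
  · rw [Fintype.mem_piFinset]
    intro i
    have h := abs_le.1 ((PiLp.norm_apply_le y i).trans hy)
    rw [Finset.mem_Icc, Int.le_floor]
    constructor
    · push_cast
      rw [le_div_iff₀ hr]
      linarith [h.1]
    · rw [← Int.cast_le (R := ℝ)]
      refine (Int.floor_le _).trans ?_
      rw [div_le_iff₀ hr]
      exact_mod_cast h.2
  · rw [EuclideanSpace.norm_eq]
    calc √(∑ i, ‖(y - WithLp.toLp 2 (fun i => r * (⌊y i / r⌋ : ℝ))) i‖ ^ 2)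
        ≤ √(∑ _i : Fin n, r ^ 2) := by
          refine Real.sqrt_le_sqrt (Finset.sum_le_sum fun i _ => ?_)
          refine pow_le_pow_left₀ (norm_nonneg _) ?_ 2
          have h1 := Int.floor_le (y i / r)
          have h2 := (Int.lt_floor_add_one (y i / r)).le
          rw [le_div_iff₀ hr] at h1
          rw [div_le_iff₀ hr] at h2
          rw [PiLp.sub_apply, Real.norm_eq_abs, abs_le]
          simp only
          constructor <;> nlinarith
      _ = r * √n := by
          rw [Finset.sum_const, Finset.card_univ, Fintype.card_fin, nsmul_eq_mul,
            Real.sqrt_mul (Nat.cast_nonneg n), Real.sqrt_sq hr.le, mul_comm]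

theorem lintegral_supOver_closedBall_le {n : ℕ} {f : En n → ℝ≥0∞} (hfu : UpperSemicontinuous f)
    {r : ℝ} (hr : 0 < r) (k : ℕ) :
    ∫⁻ x, supOver (Metric.closedBall 0 (k * r)) f x ≤
      (2 * k + 1) ^ n * ∫⁻ x, supOver (Metric.closedBall 0 (r * √n)) f x := by
  set F := Fintype.piFinset (fun _ : Fin n => Finset.Icc (-(k : ℤ)) k) with hF
  set w : (Fin n → ℤ) → En n := fun z => WithLp.toLp 2 (fun i => r * (z i : ℝ)) with hw
  set g := supOver (Metric.closedBall 0 (r * √n)) f with hg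
  have hgm : Measurable g :=
    (upperSemicontinuous_supOver (isCompact_closedBall _ _) hfu).measurable
  have hcard : (F.card : ℝ≥0∞) = (2 * k + 1) ^ n := by
    have : (k : ℤ) + 1 - -k = ((2 * k + 1 : ℕ) : ℤ) := by push_cast; ring
    rw [hF, Fintype.card_piFinset]
    simp only [Int.card_Icc, this, Int.toNat_natCast, Finset.prod_const, Finset.card_univ,
      Fintype.card_fin]
    push_cast
    rfl
  calc ∫⁻ x, supOver (Metric.closedBall 0 (k * r)) f x
      ≤ ∫⁻ x, ∑ z ∈ F, g (x + w z) := by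
        refine lintegral_mono fun x => supOver_le fun y hy => ?_
        obtain ⟨z, hz, hyz⟩ := exists_int_lattice_sub_norm_le hr k (mem_closedBall_zero_iff.1 hy)
        calc f (x + y) = f (x + w z + (y - w z)) := by congr 1; abel
          _ ≤ g (x + w z) := le_supOver f _ (mem_closedBall_zero_iff.2 hyz)
          _ ≤ _ := Finset.single_le_sum (f := fun z => g (x + w z)) (fun _ _ => zero_le) hz
    _ = ∑ z ∈ F, ∫⁻ x, g (x + w z) :=
        lintegral_finsetSum _ fun z _ => hgm.comp (measurable_add_const _)
    _ = _ := by
        simp only [lintegral_add_right_eq_self g]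
        rw [Finset.sum_const, nsmul_eq_mul, hcard]

theorem sum_raySeg_subset_closedBall {n : ℕ} {ι : Type*} {s : Finset ι} {u : ι → En n} {c ε : ℝ}
    (hc : 0 ≤ c) (hε : 0 ≤ ε) (h : ∀ x, ∑ i ∈ s, max 0 (inner ℝ x (u i)) ≤ c * ‖x‖) :
    ∑ i ∈ s, raySeg (u i) ε ⊆ Metric.closedBall 0 (ε * c) := by
  intro z hz
  rw [Set.mem_finsetSum] at hz
  obtain ⟨g, hg, rfl⟩ := hz
  set z := ∑ i ∈ s, g i with hzdef
  rw [mem_closedBall_zero_iff]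
  have hsq : ‖z‖ * ‖z‖ ≤ ε * c * ‖z‖ := by
    calc ‖z‖ * ‖z‖ = inner ℝ z z := (real_inner_self_eq_norm_mul_norm z).symm
      _ = ∑ i ∈ s, inner ℝ z (g i) := by rw [← inner_sum]
      _ ≤ ∑ i ∈ s, ε * max 0 (inner ℝ z (u i)) := by
        refine Finset.sum_le_sum fun i hi => ?_
        obtain ⟨r, ⟨hr0, hr⟩, hri⟩ := hg hi
        simp only at hri
        rw [← hri, real_inner_smul_right]
        exact (mul_le_mul_of_nonneg_left (le_max_right _ _) hr0).trans
          (mul_le_mul_of_nonneg_right hr (le_max_left _ _))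
      _ = ε * ∑ i ∈ s, max 0 (inner ℝ z (u i)) := by rw [Finset.mul_sum]
      _ ≤ ε * (c * ‖z‖) := mul_le_mul_of_nonneg_left (h z) hε
      _ = ε * c * ‖z‖ := by ring
  rcases (norm_nonneg z).eq_or_lt with h0 | h0
  · rw [← h0]; positivity
  · exact le_of_mul_le_mul_right hsq h0

theorem closedBall_subset_sum_raySeg {n : ℕ} {ι : Type*} {s : Finset ι} {u : ι → En n} {ε : ℝ}
    (hε : 0 ≤ ε) (h : ∀ x, ‖x‖ ≤ ∑ i ∈ s, max 0 (inner ℝ x (u i))) :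
    Metric.closedBall 0 ε ⊆ ∑ i ∈ s, raySeg (u i) ε := by
  intro y hy
  rw [mem_closedBall_zero_iff] at hy
  by_contra hyZ
  obtain ⟨φ, c, hφ, hc⟩ := geometric_hahn_banach_closed_point (convex_sum_raySeg s u ε)
    (isCompact_sum_raySeg s u ε).isClosed hyZ
  set x := (InnerProductSpace.toDual ℝ (En n)).symm φ
  have hx : ∀ v, φ v = inner ℝ x v := fun v => (InnerProductSpace.toDual_symm_apply).symm
  have hmem : ∑ i ∈ s, (if 0 ≤ inner ℝ x (u i) then ε else 0) • u i ∈
      ∑ i ∈ s, raySeg (u i) ε := by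
    refine Set.finsetSum_mem_finsetSum _ _ _ fun i _ => ⟨_, ?_, rfl⟩
    split_ifs
    exacts [⟨hε, le_rfl⟩, ⟨le_rfl, hε⟩]
  have h1 := hφ _ hmem
  rw [hx, inner_sum] at h1
  have h2 : ∑ i ∈ s, inner ℝ x ((if 0 ≤ inner ℝ x (u i) then ε else 0) • u i) =
      ε * ∑ i ∈ s, max 0 (inner ℝ x (u i)) := by
    rw [Finset.mul_sum]
    refine Finset.sum_congr rfl fun i _ => ?_
    rw [real_inner_smul_right]
    split_ifs with h0
    · rw [max_eq_right h0]
    · rw [max_eq_left (not_le.1 h0).le]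
      simp
  rw [h2] at h1
  rw [hx] at hc
  have h3 := real_inner_le_norm x y
  have h4 := mul_le_mul_of_nonneg_left hy (norm_nonneg x)
  have h5 := mul_le_mul_of_nonneg_left (h x) hε
  linarith

/-- The support function of the integral over the unit ball of the segments from `0`. -/
def ballSupport {n : ℕ} (x : En n) : ℝ :=
  ∫ u in Metric.closedBall (0 : En n) 1, max 0 (inner ℝ x u)

theorem continuous_max_inner {n : ℕ} (x : En n) :
    Continuous fun u : En n => max 0 (inner ℝ x u) := by
  fun_prop

theorem ballSupport_eq_of_norm_eq {n : ℕ} {x y : En n} (h : ‖x‖ = ‖y‖) :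
    ballSupport x = ballSupport y := by
  set R := (ℝ ∙ (x - y))ᗮ.reflection with hR
  have hRx : R x = y := Submodule.reflection_sub h
  have hpre : R ⁻¹' Metric.closedBall 0 1 = Metric.closedBall 0 1 := by
    ext u
    simp
  have := R.measurePreserving.setIntegral_preimage_emb
    R.toHomeomorph.measurableEmbedding (fun u => max 0 (inner ℝ y u)) (Metric.closedBall 0 1)
  rw [hpre] at this
  rw [ballSupport, ballSupport, ← this]
  refine integral_congr_ae (Eventually.of_forall fun u => ?_)
  simp only
  rw [← hRx, LinearIsometryEquiv.inner_map_map]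

theorem ballSupport_smul {n : ℕ} (x : En n) {t : ℝ} (ht : 0 ≤ t) :
    ballSupport (t • x) = t * ballSupport x := by
  rw [ballSupport, ballSupport, ← integral_const_mul]
  refine integral_congr_ae (Eventually.of_forall fun u => ?_)
  simp only
  rw [real_inner_smul_left, mul_max_of_nonneg _ _ ht, mul_zero]

theorem ballSupport_pos {n : ℕ} {e : En n} (he : ‖e‖ = 1) : 0 < ballSupport e := by
  refine (setIntegral_pos_iff_support_of_nonneg_ae (f := fun u => max 0 (inner ℝ e u))
    (Eventually.of_forall fun u => le_max_left _ _)
    ((continuous_max_inner e).continuousOn.integrableOn_compact (isCompact_closedBall _ _))).2 ?_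
  refine (Metric.measure_ball_pos volume ((1 / 2 : ℝ) • e) (by norm_num : (0 : ℝ) < 1 / 4)).trans_le
    (measure_mono fun u hu => ?_)
  rw [mem_ball_iff_norm] at hu
  have h1 := abs_le.1 ((abs_real_inner_le_norm e (u - (1 / 2 : ℝ) • e)))
  rw [inner_sub_right, real_inner_smul_right, real_inner_self_eq_norm_sq, he] at h1
  constructor
  · have : 0 < inner ℝ e u := by linarith [h1.1]
    rw [Function.mem_support, max_eq_right this.le]
    exact this.ne'
  · rw [mem_closedBall_zero_iff]
    have h2 := norm_le_insert' u ((1 / 2 : ℝ) • e)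
    rw [norm_smul, he] at h2
    norm_num at h2
    linarith

theorem exists_sum_max_inner_near_ballSupport {n : ℕ} {η : ℝ} (hη : 0 < η) :
    ∃ (s : Finset (En n)) (u : En n → En n), ∀ x,
      |∑ i ∈ s, max 0 (inner ℝ x (u i)) - ballSupport x| ≤ η * ‖x‖ := by
  set μ := (volume : Measure (En n)).restrict (Metric.closedBall 0 1) with hμ
  have : IsFiniteMeasure μ := ⟨by
    rw [hμ, Measure.restrict_apply_univ]
    exact (isCompact_closedBall _ _).measure_lt_top⟩
  have hid : MemLp (id : En n → En n) 1 μ :=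
    memLp_one_iff_integrable.2
      (continuous_id.continuousOn.integrableOn_compact (isCompact_closedBall _ _))
  obtain ⟨g, hg, hgm⟩ := hid.exists_simpleFunc_eLpNorm_sub_lt ENNReal.one_ne_top
    (ε := ENNReal.ofReal η) (by simpa using hη)
  have hgi : Integrable g μ := memLp_one_iff_integrable.1 hgm
  have hii : Integrable (id : En n → En n) μ := memLp_one_iff_integrable.1 hid
  have hnorm : ∫ u, ‖u - g u‖ ∂μ ≤ η := by
    rw [eLpNorm_one_eq_lintegral_enorm, ← ofReal_integral_norm_eq_lintegral_enorm (hii.sub hgi),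
      ENNReal.ofReal_lt_ofReal_iff hη] at hg
    exact hg.le
  refine ⟨g.range, fun v => μ.real (g ⁻¹' {v}) • v, fun x => ?_⟩
  have hcont := continuous_max_inner x
  have hLip : ∀ a b : En n, |max 0 (inner ℝ x a) - max 0 (inner ℝ x b)| ≤ ‖x‖ * ‖b - a‖ :=
    fun a b => by
    rw [max_comm 0, max_comm 0]
    refine (abs_max_sub_max_le_abs _ _ _).trans ?_
    rw [← inner_sub_right, norm_sub_rev]
    exact abs_real_inner_le_norm _ _
  have hgφ : Integrable (g.map fun v => max 0 (inner ℝ x v)) μ :=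
    SimpleFunc.integrable_of_isFiniteMeasure _
  have hsum : ∑ v ∈ g.range, max 0 (inner ℝ x (μ.real (g ⁻¹' {v}) • v)) =
      ∫ u, max 0 (inner ℝ x (g u)) ∂μ := by
    have := SimpleFunc.map_integral g (fun v => max 0 (inner ℝ x v)) hgi (by simp)
    rw [SimpleFunc.integral_eq_integral _ hgφ] at this
    refine Eq.trans (Finset.sum_congr rfl fun v _ => ?_) this.symm
    rw [real_inner_smul_right, smul_eq_mul, mul_max_of_nonneg _ _ measureReal_nonneg, mul_zero]
  have hint : Integrable (fun u => max 0 (inner ℝ x u)) μ :=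
    hcont.continuousOn.integrableOn_compact (isCompact_closedBall _ _)
  have hintg : Integrable (fun u => max 0 (inner ℝ x (g u))) μ := hgφ
  rw [hsum, ballSupport, ← integral_sub hintg hint, ← Real.norm_eq_abs]
  calc ‖∫ u, (max 0 (inner ℝ x (g u)) - max 0 (inner ℝ x u)) ∂μ‖
      ≤ ∫ u, ‖x‖ * ‖u - g u‖ ∂μ :=
        norm_integral_le_of_norm_le ((hii.sub hgi).norm.const_mul _)
          (Eventually.of_forall fun u => hLip _ _)
    _ = ‖x‖ * ∫ u, ‖u - g u‖ ∂μ := integral_const_mul _ _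
    _ ≤ ‖x‖ * η := mul_le_mul_of_nonneg_left hnorm (norm_nonneg x)
    _ = η * ‖x‖ := mul_comm _ _

theorem exists_sum_max_inner_near_norm {n : ℕ} (hn : 1 ≤ n) {δ : ℝ} (hδ : 0 < δ) :
    ∃ (s : Finset (En n)) (u : En n → En n), ∀ x,
      ‖x‖ ≤ ∑ i ∈ s, max 0 (inner ℝ x (u i)) ∧
        ∑ i ∈ s, max 0 (inner ℝ x (u i)) ≤ (1 + δ) * ‖x‖ := by
  set e : En n := EuclideanSpace.single ⟨0, hn⟩ 1
  have he : ‖e‖ = 1 := by simp [e]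
  set c := ballSupport e
  have hc : 0 < c := ballSupport_pos he
  have hsupp : ∀ x : En n, ballSupport x = c * ‖x‖ := fun x => by
    rw [ballSupport_eq_of_norm_eq (y := ‖x‖ • e) (by simp [norm_smul, he]),
      ballSupport_smul e (norm_nonneg x), mul_comm]
  obtain ⟨s, u, h⟩ := exists_sum_max_inner_near_ballSupport (n := n) (η := c * δ / (2 + δ))
    (by positivity)
  refine ⟨s, fun i => ((2 + δ) / (2 * c)) • u i, fun x => ?_⟩
  have hk : 0 ≤ (2 + δ) / (2 * c) := by positivity
  have hs : ∑ i ∈ s, max 0 (inner ℝ x (((2 + δ) / (2 * c)) • u i)) =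
      (2 + δ) / (2 * c) * ∑ i ∈ s, max 0 (inner ℝ x (u i)) := by
    rw [Finset.mul_sum]
    refine Finset.sum_congr rfl fun i _ => ?_
    rw [real_inner_smul_right, mul_max_of_nonneg _ _ hk, mul_zero]
  have hx := abs_le.1 (h x)
  rw [hsupp] at hx
  rw [hs]
  constructor
  · calc ‖x‖ = (2 + δ) / (2 * c) * (c * ‖x‖ - c * δ / (2 + δ) * ‖x‖) := by field_simp; ring
      _ ≤ _ := mul_le_mul_of_nonneg_left (by linarith [hx.1]) hk
  · calc _ ≤ (2 + δ) / (2 * c) * (c * ‖x‖ + c * δ / (2 + δ) * ‖x‖) :=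
          mul_le_mul_of_nonneg_left (by linarith [hx.2]) hk
      _ = _ := by field_simp; ring

theorem coeff_eq_zero_of_eval_natCast_le {p : Polynomial ℝ} (hp : ∀ i, 0 ≤ p.coeff i) {n : ℕ}
    {C : ℝ} (h : ∀ k : ℕ, p.eval (k : ℝ) ≤ (2 * k + 1) ^ n * C) {i : ℕ} (hi : n < i) :
    p.coeff i = 0 := by
  have hC : 0 ≤ C := by
    have h0 := h 0
    rw [Nat.cast_zero, ← Polynomial.coeff_zero_eq_eval_zero] at h0
    simpa using (hp 0).trans h0
  have hbound : ∀ k : ℕ, 1 ≤ k → p.coeff i * k ≤ 3 ^ n * C := by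
    intro k hk
    have hk1 : (1 : ℝ) ≤ k := by exact_mod_cast hk
    have hterm : p.coeff i * (k : ℝ) ^ i ≤ p.eval (k : ℝ) := by
      by_cases hid : i ∈ Finset.range (p.natDegree + 1)
      · rw [Polynomial.eval_eq_sum_range]
        exact Finset.single_le_sum (f := fun i => p.coeff i * (k : ℝ) ^ i)
          (fun j _ => mul_nonneg (hp j) (by positivity)) hid
      · rw [Polynomial.coeff_eq_zero_of_natDegree_lt (by simpa using hid), zero_mul,
          Polynomial.eval_eq_sum_range]
        exact Finset.sum_nonneg fun j _ => mul_nonneg (hp j) (by positivity)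
    have hpow : (k : ℝ) ^ n * k ≤ (k : ℝ) ^ i := by
      rw [← pow_succ]
      exact pow_le_pow_right₀ hk1 hi
    have h3 : (2 * (k : ℝ) + 1) ^ n ≤ 3 ^ n * k ^ n := by
      rw [← mul_pow]
      exact pow_le_pow_left₀ (by positivity) (by linarith) n
    have hkn : (0 : ℝ) < (k : ℝ) ^ n := by positivity
    refine le_of_mul_le_mul_left ?_ hkn
    calc (k : ℝ) ^ n * (p.coeff i * k) = p.coeff i * (k ^ n * k) := by ring
      _ ≤ p.coeff i * k ^ i := mul_le_mul_of_nonneg_left hpow (hp i)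
      _ ≤ (2 * k + 1) ^ n * C := hterm.trans (h k)
      _ ≤ 3 ^ n * k ^ n * C := mul_le_mul_of_nonneg_right h3 hC
      _ = k ^ n * (3 ^ n * C) := by ring
  by_contra hne
  have hpos : 0 < p.coeff i := lt_of_le_of_ne (hp i) (Ne.symm hne)
  obtain ⟨k, hk⟩ := exists_nat_gt (3 ^ n * C / p.coeff i)
  rw [div_lt_iff₀ hpos] at hk
  have h1 := hbound (k + 1) (by omega)
  push_cast at h1
  nlinarith

theorem exists_coeff_of_tendsto {n : ℕ} {g : ℝ → ℝ} {b : ℕ → ℕ → ℝ} (hb : ∀ m i, 0 ≤ b m i)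
    (h : ∀ ε, 0 ≤ ε →
      Tendsto (fun m => ∑ i ∈ Finset.range (n + 1), b m i * ε ^ i) atTop (𝓝 (g ε))) :
    ∃ a : ℕ → ℝ, (∀ i, 0 ≤ a i) ∧
      ∀ ε, 0 ≤ ε → g ε = ∑ i ∈ Finset.range (n + 1), a i * ε ^ i := by
  obtain ⟨C, hC⟩ := (h 1 zero_le_one).bddAbove_range
  set c : ℕ → ℕ → ℝ := fun m i => if i ∈ Finset.range (n + 1) then b m i else 0 with hc
  have hcompact : IsCompact (Set.univ.pi fun _ : ℕ => Set.Icc 0 C) :=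
    isCompact_univ_pi fun _ => isCompact_Icc
  have hcmem : ∀ m, c m ∈ Set.univ.pi fun _ : ℕ => Set.Icc 0 C := by
    intro m i _
    have hm : ∑ i ∈ Finset.range (n + 1), b m i ≤ C := by
      simpa using hC (Set.mem_range_self m)
    simp only [hc]
    split_ifs with hi
    · exact ⟨hb m i, (Finset.single_le_sum (fun j _ => hb m j) hi).trans hm⟩
    · exact ⟨le_rfl, (Finset.sum_nonneg fun j _ => hb m j).trans hm⟩
  obtain ⟨a, ha, φ, hφ, hlim⟩ := hcompact.tendsto_subseq hcmem
  refine ⟨a, fun i => (ha i trivial).1, fun ε hε => ?_⟩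
  refine tendsto_nhds_unique ((h ε hε).comp hφ.tendsto_atTop) ?_
  refine tendsto_finsetSum _ fun i hi => Tendsto.mul_const _ ?_
  have := tendsto_pi_nhds.1 hlim i
  simpa only [hc, Function.comp_apply, if_pos hi] using this

theorem lintegral_supOver_ne_top {n : ℕ} (hn : 1 ≤ n) {f : En n → ℝ≥0∞}
    (hfu : UpperSemicontinuous f) {ε : ℝ} (hε : 0 < ε)
    (h : ∫⁻ x, supOver (Metric.closedBall 0 ε) f x ≠ ∞) {K : Set (En n)}
    (hK : Bornology.IsBounded K) : ∫⁻ x, supOver K f x ≠ ∞ := by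
  have hn0 : (0 : ℝ) < √n := Real.sqrt_pos.2 (by exact_mod_cast hn)
  have hr : 0 < ε / √n := by positivity
  obtain ⟨R, hR⟩ := hK.subset_closedBall 0
  obtain ⟨k, hk⟩ := exists_nat_ge (R / (ε / √n))
  rw [div_le_iff₀ hr] at hk
  refine ne_top_of_le_ne_top ?_ ((lintegral_mono fun x => supOver_mono
    (hR.trans (Metric.closedBall_subset_closedBall hk)) f x).trans
    (lintegral_supOver_closedBall_le hfu hr k))
  rw [div_mul_cancel₀ _ hn0.ne']
  exact ENNReal.mul_ne_top (by finiteness) h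

theorem exists_coeff_sandwich {n : ℕ} (hn : 1 ≤ n) {f : En n → ℝ≥0∞} (hf : QuasiConcave f)
    (hfu : UpperSemicontinuous f)
    (hfin : ∀ K : Set (En n), IsCompact K → ∫⁻ x, supOver K f x ≠ ∞) {δ : ℝ} (hδ : 0 < δ) :
    ∃ b : ℕ → ℝ, (∀ i, 0 ≤ b i) ∧ ∀ ε, 0 ≤ ε →
      (∫⁻ x, supOver (Metric.closedBall 0 ε) f x).toReal ≤
          ∑ i ∈ Finset.range (n + 1), b i * ε ^ i ∧
        ∑ i ∈ Finset.range (n + 1), b i * ε ^ i ≤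
          (1 + δ) ^ n * (∫⁻ x, supOver (Metric.closedBall 0 ε) f x).toReal := by
  obtain ⟨s, u, hsu⟩ := exists_sum_max_inner_near_norm hn hδ
  obtain ⟨p, hp, hpe⟩ := (isRayAffine_lintegral_supOver hf hfu hfin).exists_polynomial s u 0
    isCompact_singleton (convex_singleton 0)
  simp only [zero_add] at hpe
  have hle : ∀ {K L : Set (En n)}, IsCompact L → K ⊆ L →
      (∫⁻ x, supOver K f x).toReal ≤ (∫⁻ x, supOver L f x).toReal := fun hL hKL =>
    ENNReal.toReal_mono (hfin _ hL) (lintegral_mono fun x => supOver_mono hKL f x)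
  have hδ1 : 0 < 1 + δ := by linarith
  have hlower : ∀ ε, 0 ≤ ε →
      (∫⁻ x, supOver (Metric.closedBall 0 ε) f x).toReal ≤ p.eval ε := fun ε hε => by
    rw [← hpe ε hε]
    exact hle (isCompact_sum_raySeg s u ε) (closedBall_subset_sum_raySeg hε fun x => (hsu x).1)
  have hupper : ∀ ε, 0 ≤ ε →
      p.eval ε ≤ (∫⁻ x, supOver (Metric.closedBall 0 (ε * (1 + δ))) f x).toReal := fun ε hε => by
    rw [← hpe ε hε]
    exact hle (isCompact_closedBall _ _)
      (sum_raySeg_subset_closedBall hδ1.le hε fun x => (hsu x).2)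
  have hdeg : p.natDegree < n + 1 := by
    refine Nat.lt_succ_of_le (Polynomial.natDegree_le_iff_coeff_eq_zero.2 fun i hi =>
      coeff_eq_zero_of_eval_natCast_le hp
        (C := (∫⁻ x, supOver (Metric.closedBall 0 ((1 + δ) * √n)) f x).toReal) (fun k => ?_) hi)
    refine (hupper k k.cast_nonneg).trans ?_
    have h1 := ENNReal.toReal_mono
      (ENNReal.mul_ne_top (by finiteness) (hfin _ (isCompact_closedBall _ _)))
      (lintegral_supOver_closedBall_le hfu hδ1 k)
    rw [ENNReal.toReal_mul, ENNReal.toReal_pow] at h1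
    have h2 : (2 * (k : ℝ≥0∞) + 1).toReal = 2 * k + 1 := by
      rw [ENNReal.toReal_add (by finiteness) (by finiteness)]
      simp
    rwa [h2] at h1
  refine ⟨p.coeff, hp, fun ε hε => ?_⟩
  rw [← Polynomial.eval_eq_sum_range' hdeg]
  refine ⟨hlower ε hε, ?_⟩
  have h1 := hupper (ε / (1 + δ)) (by positivity)
  rw [div_mul_cancel₀ _ hδ1.ne'] at h1
  refine le_trans ?_ (mul_le_mul_of_nonneg_left h1 (by positivity))
  rw [Polynomial.eval_eq_sum_range' hdeg, Polynomial.eval_eq_sum_range' hdeg, Finset.mul_sum]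
  refine Finset.sum_le_sum fun i hi => ?_
  rw [mul_left_comm]
  refine mul_le_mul_of_nonneg_left ?_ (hp i)
  calc ε ^ i = (1 + δ) ^ i * (ε / (1 + δ)) ^ i := by rw [← mul_pow, mul_div_cancel₀ _ hδ1.ne']
    _ ≤ (1 + δ) ^ n * (ε / (1 + δ)) ^ i :=
      mul_le_mul_of_nonneg_right
        (pow_le_pow_right₀ (by linarith) (Nat.lt_succ_iff.1 (Finset.mem_range.1 hi)))
        (by positivity)

/-- Steiner's formula when the parallel functions are integrable. -/
theorem exists_steiner_coeff {n : ℕ} (hn : 1 ≤ n) {f : En n → ℝ≥0∞} (hf : QuasiConcave f)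
    (hfu : UpperSemicontinuous f)
    (hfin : ∀ K : Set (En n), IsCompact K → ∫⁻ x, supOver K f x ≠ ∞) :
    ∃ a : ℕ → ℝ, (∀ i, 0 ≤ a i) ∧ ∀ ε, 0 ≤ ε →
      (∫⁻ x, supOver (Metric.closedBall 0 ε) f x).toReal =
        ∑ i ∈ Finset.range (n + 1), a i * ε ^ i := by
  choose b hb hbe using fun m : ℕ =>
    exists_coeff_sandwich hn hf hfu hfin (Nat.one_div_pos_of_nat (α := ℝ) (n := m))
  refine exists_coeff_of_tendsto hb fun ε hε => ?_
  refine tendsto_of_tendsto_of_tendsto_of_le_of_le tendsto_const_nhds ?_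
    (fun m => (hbe m ε hε).1) (fun m => (hbe m ε hε).2)
  simpa using (((tendsto_one_div_add_atTop_nhds_zero_nat (𝕜 := ℝ)).const_add 1).pow n).mul_const
    (∫⁻ x, supOver (Metric.closedBall 0 ε) f x).toReal

theorem feps_eq_oplus_odot_indD {n : ℕ} {f : En n → ℝ≥0∞} (hf1 : ∀ x, f x ≤ 1) {ε : ℝ}
    (hε : 0 < ε) : feps f ε = oplus f (odot ε indD) := by
  have hind : ∀ z : En n, odot ε indD z = if ‖z‖ ≤ ε then 1 else 0 := fun z => by
    simp only [odot, indD, norm_smul, norm_inv, Real.norm_of_nonneg hε.le, inv_mul_le_iff₀ hε,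
      mul_one]
  ext x
  apply le_antisymm
  · refine iSup₂_le fun y hy => le_iSup_of_le (x + y) ?_
    rw [hind, sub_add_cancel_left, norm_neg, if_pos hy, min_eq_left (hf1 _)]
  · refine iSup_le fun y => ?_
    rw [hind]
    split_ifs with h
    · refine (min_le_left _ _).trans ?_
      refine le_iSup₂_of_le (y - x) (by rwa [norm_sub_rev]) ?_
      rw [add_sub_cancel]
    · simp

end Steiner

theorem stmt5 (n : ℕ) (hn : 1 ≤ n) (f : En n → ℝ≥0∞)
    (hf : QC f) (hf1 : ∀ x, f x ≤ 1) :
    (∀ ε : ℝ, 0 < ε → feps f ε = oplus f (odot ε indD)) ∧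
    ∃ W : ℕ → ℝ≥0∞, W 0 = (∫⁻ x, f x) ∧
      ∀ ε : ℝ, 0 < ε →
        ∫⁻ x, feps f ε x =
          ∑ i ∈ Finset.range (n + 1),
            (n.choose i : ℝ≥0∞) * W i * ENNReal.ofReal ε ^ i := by
  obtain ⟨hfu, hfq, -⟩ := hf
  refine ⟨fun ε hε => feps_eq_oplus_odot_indD hf1 hε, ?_⟩
  simp only [feps_eq_supOver]
  by_cases htop : ∃ ε : ℝ, 0 < ε ∧ ∫⁻ x, supOver (Metric.closedBall 0 ε) f x ≠ ∞
  · obtain ⟨ε₀, hε₀, h₀⟩ := htop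
    have hfin : ∀ K : Set (En n), IsCompact K → ∫⁻ x, supOver K f x ≠ ∞ := fun K hK =>
      lintegral_supOver_ne_top hn hfu hε₀ h₀ hK.isBounded
    obtain ⟨a, ha, hae⟩ := exists_steiner_coeff hn hfq hfu hfin
    refine ⟨fun i => ENNReal.ofReal (a i) / n.choose i, ?_, fun ε hε => ?_⟩
    · have h0 := hae 0 le_rfl
      rw [Finset.sum_range_succ', Metric.closedBall_zero] at h0
      simp only [ne_eq, Nat.add_eq_zero_iff, one_ne_zero, and_false, not_false_eq_true, zero_pow,
        mul_zero, Finset.sum_const_zero, zero_add, pow_zero, mul_one] at h0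
      simp only
      rw [← h0, ENNReal.ofReal_toReal (hfin _ isCompact_singleton)]
      simp [supOver]
    · rw [← ENNReal.ofReal_toReal (hfin _ (isCompact_closedBall 0 ε)), hae ε hε.le,
        ENNReal.ofReal_sum_of_nonneg fun i _ => mul_nonneg (ha i) (by positivity)]
      refine Finset.sum_congr rfl fun i hi => ?_
      have hchoose : (n.choose i : ℝ≥0∞) ≠ 0 := by
        exact_mod_cast (Nat.choose_pos (Nat.lt_succ_iff.1 (Finset.mem_range.1 hi))).ne'
      rw [ENNReal.mul_div_cancel hchoose (ENNReal.natCast_ne_top _),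
        ENNReal.ofReal_mul (ha i), ENNReal.ofReal_pow hε.le]
  · push Not at htop
    refine ⟨fun i => if i = 0 then ∫⁻ x, f x else ∞, by simp, fun ε hε => ?_⟩
    rw [htop ε hε]
    symm
    refine ENNReal.sum_eq_top.2 ⟨1, Finset.mem_range.2 (by omega), ?_⟩
    have hn0 : (n : ℝ≥0∞) ≠ 0 := by exact_mod_cast (by omega : n ≠ 0)
    simp only
    rw [Nat.choose_one_right, if_neg one_ne_zero, ENNReal.mul_top hn0, pow_one,
      ENNReal.top_mul (by simpa using hε)]
end
end
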